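/- Let N ≥ 2, let f ∈ L^1(S^N) and let α > (N-1)/2. Then there exists a constant c_α, not depending on f, such that for every x ∈ S^N the Cesàro maximal operator satisfies S_*^α f(x) ≤ c_α ( f*(x) + f*(x̄) ), where f* is the Hardy–Littlewood maximal function on the sphere and x̄ is the point of S^N diametrically opposite to x. -/

import Mathlib

open MeasureTheory Metric Real Filter
open scoped BigOperators ENNReal NNReal RealInnerProductSpace Topology

noncomputable section

/-- The unit sphere `S^N` as a subtype of `ℝ^{N+1}` (with the Euclidean structure). -/
abbrev Sph (N : ℕ) : Type := Metric.sphere (0 : EuclideanSpace ℝ (Fin (N + 1))) 1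

/-- The surface measure `σ` on the sphere `S^N`. -/
def sphMeasure (N : ℕ) : Measure (Sph N) :=
  (volume : Measure (EuclideanSpace ℝ (Fin (N + 1)))).toSphere

/-- The spherical (geodesic) distance `γ(x,y) ∈ [0,π]` between two points of `S^N`. -/
def geoDist {N : ℕ} (x y : Sph N) : ℝ :=
  Real.arccos ⟪(x : EuclideanSpace ℝ (Fin (N + 1))), (y : EuclideanSpace ℝ (Fin (N + 1)))⟫

/-- The spherical ball `B(x,r) = {y : γ(x,y) ≤ r}`. -/
def sphBall {N : ℕ} (x : Sph N) (r : ℝ) : Set (Sph N) := {y | geoDist x y ≤ r}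

/-- The point of the sphere diametrically opposite to `x`. -/
def antipode {N : ℕ} (x : Sph N) : Sph N :=
  ⟨-(x : EuclideanSpace ℝ (Fin (N + 1))), by
    have hx := x.2
    simp only [mem_sphere_iff_norm, sub_zero, norm_neg] at hx ⊢
    exact hx⟩

/-- A spherical harmonic of degree `k` on `S^N`: the restriction to the sphere of a
homogeneous polynomial of degree `k` on `ℝ^{N+1}` annihilated by the Euclidean Laplacian
(equivalently, an eigenfunction of the Laplace–Beltrami operator `−Δ_s` with
eigenvalue `k(k+N−1)`). -/
def IsSphericalHarmonic (N k : ℕ) (g : Sph N → ℝ) : Prop :=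
  ∃ P : MvPolynomial (Fin (N + 1)) ℝ,
    P.IsHomogeneous k ∧
    (∑ i, MvPolynomial.pderiv i (MvPolynomial.pderiv i P)) = 0 ∧
    ∀ x : Sph N, g x = MvPolynomial.eval (fun i => (x : EuclideanSpace ℝ (Fin (N + 1))) i) P

/-- `Y k j`, `j < a k`, is for each `k` an orthonormal basis (w.r.t. `L²(S^N, σ)`)
of the space `ℵ_k` of spherical harmonics of degree `k`. -/
structure IsFourierLaplaceBasis (N : ℕ) (a : ℕ → ℕ) (Y : (k : ℕ) → Fin (a k) → Sph N → ℝ) :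
    Prop where
  harmonic : ∀ k j, IsSphericalHarmonic N k (Y k j)
  orthonormal : ∀ k, ∀ j j' : Fin (a k),
    ∫ x, Y k j x * Y k j' x ∂(sphMeasure N) = if j = j' then 1 else 0
  spanning : ∀ k (g : Sph N → ℝ), IsSphericalHarmonic N k g →
    g ∈ Submodule.span ℝ (Set.range (Y k))

/-- The Cesàro number `A_m^α = Γ(α+m+1)/(Γ(α+1) m!)`. -/
def cesaroA (α : ℝ) (m : ℕ) : ℝ :=
  Real.Gamma (α + m + 1) / (Real.Gamma (α + 1) * (Nat.factorial m))

/-- The Fourier–Laplace coefficient `f_{k,j} = ∫_{S^N} f(y) Y_j^k(y) dσ(y)`. -/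
def flCoeff {N : ℕ} {a : ℕ → ℕ} (Y : (k : ℕ) → Fin (a k) → Sph N → ℝ) (f : Sph N → ℝ)
    (k : ℕ) (j : Fin (a k)) : ℝ :=
  ∫ y, f y * Y k j y ∂(sphMeasure N)

/-- The Cesàro mean of order `α` of the Fourier–Laplace series of `f`:
`S_n^α f(x) = (1/A_n^α) Σ_{k=0}^n A_{n−k}^α Σ_{j=1}^{a_k} f_{k,j} Y_j^k(x)`. -/
def cesaroMean {N : ℕ} {a : ℕ → ℕ} (Y : (k : ℕ) → Fin (a k) → Sph N → ℝ) (α : ℝ)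
    (f : Sph N → ℝ) (n : ℕ) (x : Sph N) : ℝ :=
  (cesaroA α n)⁻¹ *
    ∑ k ∈ Finset.range (n + 1), cesaroA α (n - k) * ∑ j, flCoeff Y f k j * Y k j x

/-- The maximal operator `S_*^α f(x) = sup_{n ≥ 1} |S_n^α f(x)|` (with values in `ℝ≥0∞`). -/
def cesaroMaximal {N : ℕ} {a : ℕ → ℕ} (Y : (k : ℕ) → Fin (a k) → Sph N → ℝ) (α : ℝ)
    (f : Sph N → ℝ) (x : Sph N) : ℝ≥0∞ :=
  ⨆ (n : ℕ) (_ : 1 ≤ n), ENNReal.ofReal |cesaroMean Y α f n x|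

/-- The Hardy–Littlewood maximal function
`f*(x) = sup_{r>0} (1/σ(B(x,r))) ∫_{B(x,r)} |f| dσ` (with values in `ℝ≥0∞`). -/
def hlMaximal {N : ℕ} (f : Sph N → ℝ) (x : Sph N) : ℝ≥0∞ :=
  ⨆ (r : ℝ) (_ : 0 < r),
    (sphMeasure N (sphBall x r))⁻¹ * ∫⁻ y in sphBall x r, ENNReal.ofReal |f y| ∂(sphMeasure N)

/-- The Cesàro means of order `α` of the spectral function:
`Θ^α(x,y,n) = (1/A_n^α) Σ_{k=0}^n A_{n−k}^α Σ_{j=1}^{a_k} Y_j^k(x) Y_j^k(y)`. -/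
def cesaroKernel {N : ℕ} {a : ℕ → ℕ} (Y : (k : ℕ) → Fin (a k) → Sph N → ℝ) (α : ℝ)
    (n : ℕ) (x y : Sph N) : ℝ :=
  (cesaroA α n)⁻¹ *
    ∑ k ∈ Finset.range (n + 1), cesaroA α (n - k) * ∑ j, Y k j x * Y k j y

section GegenbauerRecurrence

variable {A : Type*} [CommRing A] [Algebra ℝ A]

/-- The homogenized Gegenbauer polynomials `C_k^μ(T, Q)`, i.e. the coefficients of `r ^ k` in
`(1 - 2 r T + r² Q) ^ (-μ)`, with the index shifted by two: `gegenbauer μ T Q (k + 2)` is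
`C_k^μ(T, Q)` and the first two terms vanish. -/
def gegenbauer (μ : ℝ) (T Q : A) : ℕ → A
  | 0 => 0
  | 1 => 0
  | 2 => 1
  | (n + 3) => ((n : ℝ) + 1)⁻¹ • ((2 * (n + μ)) • (T * gegenbauer μ T Q (n + 2))
      - (n - 1 + 2 * μ) • (Q * gegenbauer μ T Q (n + 1)))

lemma cancel_natCast_succ {n : ℕ} {x y : A} (h : ((n : A) + 1) * x = ((n : A) + 1) * y) :
    x = y := by
  have hn : ((n : ℝ) + 1) ≠ 0 := by positivity
  have h' : ((n : ℝ) + 1) • x = ((n : ℝ) + 1) • y := by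
    simpa [Algebra.smul_def] using h
  exact (IsUnit.mk0 _ hn).smul_left_cancel.1 h'

lemma gegenbauer_rec (μ : ℝ) (T Q : A) (n : ℕ) :
    (n : A) * gegenbauer μ T Q (n + 2)
      = 2 * (n - 1 + algebraMap ℝ A μ) * T * gegenbauer μ T Q (n + 1)
        - (n - 2 + 2 * algebraMap ℝ A μ) * Q * gegenbauer μ T Q n := by
  rcases n with _ | n
  · simp [gegenbauer]
  · have hn : ((n : ℝ) + 1) ≠ 0 := by positivity
    have h : ((n : ℝ) + 1) • gegenbauer μ T Q (n + 3)
        = (2 * (n + μ)) • (T * gegenbauer μ T Q (n + 2))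
          - (n - 1 + 2 * μ) • (Q * gegenbauer μ T Q (n + 1)) := by
      rw [gegenbauer, smul_inv_smul₀ hn]
    simp only [Algebra.smul_def, map_add, map_mul, map_sub, map_natCast, map_one, map_ofNat] at h
    push_cast
    linear_combination h

lemma map_gegenbauer {B : Type*} [CommRing B] [Algebra ℝ B] (φ : A →ₐ[ℝ] B) (μ : ℝ) (T Q : A)
    (n : ℕ) : φ (gegenbauer μ T Q n) = gegenbauer μ (φ T) (φ Q) n := by
  induction n using Nat.strong_induction_on with
  | _ n ih =>
    match n with
    | 0 => simp [gegenbauer]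
    | 1 => simp [gegenbauer]
    | 2 => simp [gegenbauer]
    | n + 3 =>
      rw [gegenbauer, gegenbauer, ← ih (n + 2) (by omega), ← ih (n + 1) (by omega)]
      simp

lemma gegenbauer_eq_add_one (μ : ℝ) (T Q : A) (n : ℕ) :
    gegenbauer μ T Q (n + 2) = gegenbauer (μ + 1) T Q (n + 2)
      - 2 * T * gegenbauer (μ + 1) T Q (n + 1) + Q * gegenbauer (μ + 1) T Q n := by
  induction n using Nat.strong_induction_on with
  | _ n ih =>
    match n with
    | 0 => simp [gegenbauer]
    | 1 =>
      simp only [gegenbauer, Algebra.smul_def]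
      have h2 : algebraMap ℝ A 2 = 2 := map_ofNat _ 2
      simp [h2]
      ring
    | n + 2 =>
      apply cancel_natCast_succ (n := n + 1)
      have h1 := gegenbauer_rec μ T Q (n + 2)
      have e2 := gegenbauer_rec (μ + 1) T Q (n + 2)
      have e1 := gegenbauer_rec (μ + 1) T Q (n + 1)
      have e0 := gegenbauer_rec (μ + 1) T Q n
      have i1 := ih (n + 1) (by omega)
      have i0 := ih n (by omega)
      simp only [add_assoc, Nat.reduceAdd, map_add, map_one] at *
      rw [i1, i0] at h1
      push_cast at *
      linear_combination h1 - e2 + 2 * T * e1 - Q * e0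

lemma gegenbauer_sub (μ : ℝ) (T Q : A) (n : ℕ) :
    (n + algebraMap ℝ A μ) * gegenbauer μ T Q (n + 2) = algebraMap ℝ A μ *
      (gegenbauer (μ + 1) T Q (n + 2) - Q * gegenbauer (μ + 1) T Q n) := by
  have e0 := gegenbauer_rec (μ + 1) T Q n
  rw [gegenbauer_eq_add_one]
  simp only [map_add, map_one] at e0
  linear_combination e0

lemma gegenbauer_sub_mul (μ : ℝ) (T Q : A) (n : ℕ) :
    (n + 2 * algebraMap ℝ A μ) * gegenbauer μ T Q (n + 2) = 2 * algebraMap ℝ A μ *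
      (gegenbauer (μ + 1) T Q (n + 2) - T * gegenbauer (μ + 1) T Q (n + 1)) := by
  have e0 := gegenbauer_rec (μ + 1) T Q n
  rw [gegenbauer_eq_add_one]
  simp only [map_add, map_one] at e0
  linear_combination e0

lemma derivation_gegenbauer (D : Derivation ℝ A A) (μ : ℝ) (T Q : A) (n : ℕ) :
    D (gegenbauer μ T Q (n + 2)) = algebraMap ℝ A μ *
      (2 * D T * gegenbauer (μ + 1) T Q (n + 1) - D Q * gegenbauer (μ + 1) T Q n) := by
  have d2 : D (2 : A) = 0 := D.map_natCast 2
  induction n using Nat.strong_induction_on with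
  | _ n ih =>
    match n with
    | 0 => simp [gegenbauer]
    | 1 =>
      simp only [gegenbauer, Algebra.smul_def]
      have h2 : algebraMap ℝ A 2 = 2 := map_ofNat _ 2
      simp [h2, d2]
      ring
    | n + 2 =>
      apply cancel_natCast_succ (n := n + 1)
      have h1 := congrArg D (gegenbauer_rec μ T Q (n + 2))
      simp only [Derivation.leibniz, map_sub, map_add, Derivation.map_natCast, smul_eq_mul,
        Derivation.map_algebraMap, Derivation.map_one_eq_zero] at h1
      have i1 := ih (n + 1) (by omega)
      have i0 := ih n (by omega)
      have e2 := gegenbauer_rec (μ + 1) T Q (n + 1)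
      have e1 := gegenbauer_rec (μ + 1) T Q n
      have r1 := gegenbauer_sub μ T Q (n + 1)
      have r0 := gegenbauer_sub_mul μ T Q n
      simp only [add_assoc, Nat.reduceAdd, map_add, map_one] at *
      rw [i1, i0] at h1
      simp only [d2] at h1
      push_cast at *
      linear_combination h1 + 2 * D T * r1 - D Q * r0
        - 2 * algebraMap ℝ A μ * D T * e2 + algebraMap ℝ A μ * D Q * e1

end GegenbauerRecurrence

section HarmonicGegenbauer

open MvPolynomial

variable {ι : Type*} [Fintype ι]

/-- The linear form `x ↦ ∑ i, y i * x i`. -/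
def linForm (y : ι → ℝ) : MvPolynomial ι ℝ := ∑ i, C (y i) * X i

/-- The quadratic form `x ↦ ∑ i, x i ^ 2`. -/
def sumSq (ι : Type*) [Fintype ι] : MvPolynomial ι ℝ := ∑ i, X i ^ 2

lemma isHomogeneous_linForm (y : ι → ℝ) : (linForm y).IsHomogeneous 1 :=
  IsHomogeneous.sum _ _ _ fun i _ => by
    simpa using (isHomogeneous_C ι (y i)).mul (isHomogeneous_X ℝ i)

lemma isHomogeneous_sumSq : (sumSq ι).IsHomogeneous 2 :=
  IsHomogeneous.sum _ _ _ fun i _ => by simpa using (isHomogeneous_X ℝ i).pow 2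

lemma pderiv_linForm (y : ι → ℝ) (i : ι) : pderiv i (linForm y) = C (y i) := by
  classical
  simp [linForm, Derivation.leibniz, pderiv_X, Pi.single_apply]

lemma pderiv_sumSq (i : ι) : pderiv i (sumSq ι) = 2 * X i := by
  classical
  simp [sumSq, pderiv_X, Pi.single_apply, Derivation.leibniz_pow]

lemma isHomogeneous_gegenbauer (μ : ℝ) (y : ι → ℝ) (n : ℕ) :
    (gegenbauer μ (linForm y) (sumSq ι) (n + 2)).IsHomogeneous n := by
  induction n using Nat.strong_induction_on with
  | _ n ih =>
    match n with
    | 0 => simpa [gegenbauer] using isHomogeneous_one ι ℝ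
    | 1 =>
      have := (isHomogeneous_C ι (2 * μ)).mul (isHomogeneous_linForm y)
      simpa [gegenbauer, smul_eq_C_mul] using this
    | n + 2 =>
      rw [gegenbauer, smul_eq_C_mul, smul_eq_C_mul, smul_eq_C_mul]
      have h1 := (isHomogeneous_C ι (2 * (((n + 1 : ℕ) : ℝ) + μ))).mul
        ((isHomogeneous_linForm y).mul (ih (n + 1) (by omega)))
      have h0 := (isHomogeneous_C ι (((n + 1 : ℕ) : ℝ) - 1 + 2 * μ)).mul
        ((isHomogeneous_sumSq (ι := ι)).mul (ih n (by omega)))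
      rw [show 0 + (1 + (n + 1)) = n + 2 by ring] at h1
      rw [show 0 + (2 + n) = n + 2 by ring] at h0
      simpa using (isHomogeneous_C ι _).mul (h1.sub h0)

lemma sum_C_mul_pderiv_gegenbauer (μ : ℝ) {y : ι → ℝ} (hy : ∑ i, y i ^ 2 = 1) (n : ℕ) :
    ∑ i, C (y i) * pderiv i (gegenbauer μ (linForm y) (sumSq ι) (n + 2))
      = 2 * C μ * (gegenbauer (μ + 1) (linForm y) (sumSq ι) (n + 1)
        - linForm y * gegenbauer (μ + 1) (linForm y) (sumSq ι) n) := by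
  have hy' : ∑ i, (C (y i) : MvPolynomial ι ℝ) * C (y i) = 1 := by
    simp_rw [← C_mul, ← map_sum, ← pow_two, hy, C_1]
  simp_rw [derivation_gegenbauer, pderiv_linForm, pderiv_sumSq]
  trans ∑ i, (2 * C μ * gegenbauer (μ + 1) (linForm y) (sumSq ι) (n + 1) * (C (y i) * C (y i))
      - 2 * C μ * gegenbauer (μ + 1) (linForm y) (sumSq ι) n * (C (y i) * X i))
  · refine Finset.sum_congr rfl fun i _ => ?_
    simp only [algebraMap_eq]
    ring
  · rw [Finset.sum_sub_distrib, ← Finset.mul_sum, ← Finset.mul_sum, hy', ← linForm]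
    ring

lemma sum_X_mul_pderiv_gegenbauer (μ : ℝ) (y : ι → ℝ) (n : ℕ) :
    ∑ i, X i * pderiv i (gegenbauer μ (linForm y) (sumSq ι) n)
      = ((n : MvPolynomial ι ℝ) - 2) * gegenbauer μ (linForm y) (sumSq ι) n := by
  match n with
  | 0 => simp [gegenbauer]
  | 1 => simp [gegenbauer]
  | n + 2 =>
    rw [(isHomogeneous_gegenbauer μ y n).sum_X_mul_pderiv]
    simp

/-- The zonal polynomials attached to the Gegenbauer polynomials are harmonic. -/
lemma laplacian_gegenbauer (μ : ℝ) (hμ : (Fintype.card ι : ℝ) = 2 * μ + 2) {y : ι → ℝ}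
    (hy : ∑ i, y i ^ 2 = 1) (n : ℕ) :
    ∑ i, pderiv i (pderiv i (gegenbauer μ (linForm y) (sumSq ι) n)) = 0 := by
  match n with
  | 0 => simp [gegenbauer]
  | 1 => simp [gegenbauer]
  | n + 2 =>
    set e := gegenbauer (μ + 1) (linForm y) (sumSq ι) with he
    have hcard : (Fintype.card ι : MvPolynomial ι ℝ) = 2 * C μ + 2 := by
      have := congrArg (C (σ := ι)) hμ
      simpa [show (C 2 : MvPolynomial ι ℝ) = 2 from map_ofNat C 2] using this
    have d2 (i : ι) : pderiv i (2 : MvPolynomial ι ℝ) = 0 := (pderiv i).map_natCast 2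
    have h (i : ι) : pderiv i (pderiv i (gegenbauer μ (linForm y) (sumSq ι) (n + 2)))
        = 2 * C μ * (C (y i) * pderiv i (e (n + 1))) - 2 * C μ * e n
          - 2 * C μ * (X i * pderiv i (e n)) := by
      rw [derivation_gegenbauer, pderiv_linForm, pderiv_sumSq, ← he]
      simp only [algebraMap_eq, Derivation.leibniz, map_sub, pderiv_C, pderiv_X_self, d2,
        smul_eq_mul]
      ring
    simp_rw [h]
    rw [Finset.sum_sub_distrib, Finset.sum_sub_distrib, ← Finset.mul_sum, ← Finset.mul_sum,
      ← Finset.mul_sum, sum_X_mul_pderiv_gegenbauer, Finset.sum_const, Finset.card_univ,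
      nsmul_eq_mul, hcard]
    match n with
    | 0 => simp [he, gegenbauer]
    | 1 => simp [he, gegenbauer]
    | n + 2 =>
      rw [he, sum_C_mul_pderiv_gegenbauer _ hy]
      have h3 := gegenbauer_sub_mul (μ + 1) (linForm y) (sumSq ι) n
      simp only [algebraMap_eq, add_assoc, C_add, C_1] at h3 ⊢
      push_cast at h3 ⊢
      linear_combination (-2 * C μ) * h3

end HarmonicGegenbauer

section GeneratingFunction

open PowerSeries

/-- The coefficient `a (a + 1) ⋯ (a + n - 1) / n!` of `z ^ n` in `(1 - z) ^ (-a)`. -/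
def risingCoeff (a : ℝ) (n : ℕ) : ℝ := ∏ j ∈ Finset.range n, (a + j) / (j + 1)

lemma risingCoeff_zero (a : ℝ) : risingCoeff a 0 = 1 := rfl

lemma succ_mul_risingCoeff (a : ℝ) (n : ℕ) :
    (n + 1) * risingCoeff a (n + 1) = (a + n) * risingCoeff a n := by
  have : (n : ℝ) + 1 ≠ 0 := by positivity
  rw [risingCoeff, Finset.prod_range_succ, ← risingCoeff]
  field_simp

lemma ringChoose_eq_risingCoeff (a : ℝ) (n : ℕ) :
    Ring.choose ((a : ℂ) + n - 1) n = (risingCoeff a n : ℂ) := by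
  rw [← Ring.multichoose_eq]
  have h := Ring.factorial_nsmul_multichoose_eq_ascPochhammer (a : ℂ) n
  have hn : (n.factorial : ℂ) ≠ 0 := by exact_mod_cast n.factorial_ne_zero
  have key : (n.factorial : ℂ) * (risingCoeff a n : ℂ)
      = (ascPochhammer ℕ n).smeval (a : ℂ) := by
    clear h hn
    induction n with
    | zero => simp [risingCoeff_zero]
    | succ n ih =>
      have hs : ((n : ℂ) + 1) * (risingCoeff a (n + 1) : ℂ) = (a + n) * (risingCoeff a n : ℂ) := by
        exact_mod_cast succ_mul_risingCoeff a n
      rw [ascPochhammer_succ_right, Polynomial.smeval_mul, ← ih, Nat.factorial_succ]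
      simp only [Polynomial.smeval_add, Polynomial.smeval_X, Polynomial.smeval_natCast,
        nsmul_eq_mul, pow_zero, pow_one, mul_one]
      push_cast
      linear_combination (n.factorial : ℂ) * hs
  rw [nsmul_eq_mul, ← key] at h
  exact mul_left_cancel₀ hn h

/-- The power series of `(1 - u z) ^ (-a)`. -/
def binomSeries (a : ℝ) (u : ℂ) : PowerSeries ℂ := mk fun n => (risingCoeff a n : ℂ) * u ^ n

lemma derivative_binomSeries (a : ℝ) (u : ℂ) :
    (1 - C u * X) * d⁄dX ℂ (binomSeries a u) = C (a * u) * binomSeries a u := by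
  ext n
  have hs : ((n : ℂ) + 1) * (risingCoeff a (n + 1) : ℂ) = (a + n) * (risingCoeff a n : ℂ) := by
    exact_mod_cast succ_mul_risingCoeff a n
  rw [sub_mul, one_mul, mul_assoc, map_sub, coeff_C_mul, coeff_C_mul]
  rcases n with _ | n
  · simp [binomSeries, coeff_derivative, -coeff_zero_eq_constantCoeff] at hs ⊢
    rw [coeff_zero_X_mul]
    linear_combination u * hs
  · rw [coeff_succ_X_mul]
    simp only [binomSeries, coeff_derivative, coeff_mk]
    push_cast at hs ⊢
    linear_combination u ^ (n + 2) * hs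

lemma coeff_binomSeries_mul (μ t : ℝ) {u v : ℂ} (huv : u * v = 1) (ht : u + v = 2 * t) (n : ℕ) :
    coeff n (binomSeries μ u * binomSeries μ v) = (gegenbauer μ t 1 (n + 2) : ℝ) := by
  set f := binomSeries μ u * binomSeries μ v with hf
  have hd : d⁄dX ℂ f - C ((2 * t : ℝ) : ℂ) * (X * d⁄dX ℂ f) + X * (X * d⁄dX ℂ f)
      = C ((2 * μ * t : ℝ) : ℂ) * f - C ((2 * μ : ℝ) : ℂ) * (X * f) := by
    have h1 := derivative_binomSeries μ u
    have h2 := derivative_binomSeries μ v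
    have c1 : (C u * C v : PowerSeries ℂ) = 1 := by rw [← map_mul, huv, map_one]
    have c2 : (C ((2 * t : ℝ) : ℂ) : PowerSeries ℂ) = C u + C v := by
      rw [← map_add, ht]; push_cast; rfl
    have c3 : (C ((2 * μ * t : ℝ) : ℂ) : PowerSeries ℂ) = C (μ : ℂ) * (C u + C v) := by
      rw [← map_add, ht, ← map_mul]; push_cast; congr 1; ring
    have c4 : (C ((2 * μ : ℝ) : ℂ) : PowerSeries ℂ) = C (μ : ℂ) * 2 := by
      rw [show (2 : PowerSeries ℂ) = C 2 from (map_ofNat C 2).symm, ← map_mul]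
      push_cast; congr 1; ring
    rw [map_mul] at h1 h2
    rw [hf, Derivation.leibniz, smul_eq_mul, smul_eq_mul, c2, c3, c4]
    linear_combination (binomSeries μ v * (1 - C v * X)) * h1
      + (binomSeries μ u * (1 - C u * X)) * h2
      - (X * X * (binomSeries μ u * d⁄dX ℂ (binomSeries μ v)
        + binomSeries μ v * d⁄dX ℂ (binomSeries μ u))
        + 2 * C (μ : ℂ) * X * binomSeries μ u * binomSeries μ v) * c1
  have hrec (m : ℕ) := congrArg (coeff m) hd
  simp only [map_sub, map_add, coeff_C_mul] at hrec
  induction n using Nat.strong_induction_on with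
  | _ n ih =>
    match n with
    | 0 => simp [hf, binomSeries, gegenbauer, risingCoeff_zero]
    | 1 =>
      have h := hrec 0
      have h0 : coeff 0 f = 1 := by simpa [gegenbauer] using ih 0 (by omega)
      rw [coeff_derivative, h0] at h
      simp at h
      simp [h, gegenbauer]
    | n + 2 =>
      have h := hrec (n + 1)
      have i1 := ih (n + 1) (by omega)
      have i0 := ih n (by omega)
      have e := congrArg (fun x : ℝ => (x : ℂ)) (gegenbauer_rec μ t 1 (n + 2))
      simp only [Algebra.algebraMap_self, RingHom.id_apply, mul_one] at e
      have hx : coeff (n + 1) (X * (X * d⁄dX ℂ f)) = n * coeff n f := by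
        rw [coeff_succ_X_mul]
        rcases n with _ | n
        · simp
        · rw [coeff_succ_X_mul, coeff_derivative]; push_cast; ring
      rw [hx, coeff_succ_X_mul, coeff_succ_X_mul, coeff_derivative, coeff_derivative, i1, i0] at h
      have hn : ((n : ℂ) + 2) ≠ 0 := by exact_mod_cast (by omega : n + 2 ≠ 0)
      apply mul_left_cancel₀ hn
      push_cast at h e ⊢
      simp only [add_assoc, Nat.reduceAdd] at h e ⊢
      linear_combination h - e

end GeneratingFunction

section CoefficientBound

open PowerSeries

/-- The power series `p` converges absolutely to `F` on the open unit disc. -/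
def HasAbsSum (p : PowerSeries ℂ) (F : ℂ → ℂ) : Prop :=
  ∀ z : ℂ, ‖z‖ < 1 → (Summable fun n => ‖coeff n p * z ^ n‖) ∧ ∑' n, coeff n p * z ^ n = F z

lemma HasAbsSum.mul {p q : PowerSeries ℂ} {F G : ℂ → ℂ} (hp : HasAbsSum p F)
    (hq : HasAbsSum q G) : HasAbsSum (p * q) fun z => F z * G z := by
  intro z hz
  obtain ⟨sp, tp⟩ := hp z hz
  obtain ⟨sq, tq⟩ := hq z hz
  have key (n : ℕ) : coeff n (p * q) * z ^ n = ∑ kl ∈ Finset.HasAntidiagonal.antidiagonal n,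
      (coeff kl.1 p * z ^ kl.1) * (coeff kl.2 q * z ^ kl.2) := by
    rw [coeff_mul, Finset.sum_mul]
    refine Finset.sum_congr rfl fun kl hkl => ?_
    rw [← Finset.HasAntidiagonal.mem_antidiagonal.1 hkl, pow_add]
    ring
  have s1 := summable_norm_sum_mul_antidiagonal_of_summable_norm sp sq
  have s2 := tsum_mul_tsum_eq_tsum_sum_antidiagonal_of_summable_norm sp sq
  rw [tp, tq] at s2
  exact ⟨s1.congr fun n => congrArg norm (key n).symm, (tsum_congr key).trans s2.symm⟩

lemma hasAbsSum_one : HasAbsSum 1 fun _ => 1 := by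
  intro z _
  have h (n : ℕ) (hn : n ≠ 0) : coeff n (1 : PowerSeries ℂ) * z ^ n = 0 := by
    simp [coeff_one, hn]
  refine ⟨summable_of_ne_finset_zero (s := {0}) fun n hn => ?_, ?_⟩
  · rw [h n (by simpa using hn), norm_zero]
  · rw [tsum_eq_single 0 h]; simp

lemma hasAbsSum_X : HasAbsSum X fun z => z := by
  intro z _
  have h (n : ℕ) (hn : n ≠ 1) : coeff n (X : PowerSeries ℂ) * z ^ n = 0 := by
    simp [coeff_X, hn]
  refine ⟨summable_of_ne_finset_zero (s := {1}) fun n hn => ?_, ?_⟩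
  · rw [h n (by simpa using hn), norm_zero]
  · rw [tsum_eq_single 1 h]; simp

lemma HasAbsSum.sub {p q : PowerSeries ℂ} {F G : ℂ → ℂ} (hp : HasAbsSum p F)
    (hq : HasAbsSum q G) : HasAbsSum (p - q) fun z => F z - G z := by
  intro z hz
  obtain ⟨sp, tp⟩ := hp z hz
  obtain ⟨sq, tq⟩ := hq z hz
  simp_rw [map_sub, sub_mul]
  refine ⟨(sp.add sq).of_nonneg_of_le (fun _ => norm_nonneg _) fun n => norm_sub_le _ _, ?_⟩
  rw [sp.of_norm.tsum_sub sq.of_norm, tp, tq]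

lemma mem_eball_zero_one_iff (z : ℂ) : z ∈ Metric.eball (0 : ℂ) 1 ↔ ‖z‖ < 1 := by
  rw [← ENNReal.ofReal_one, Metric.eball_ofReal, mem_ball_zero_iff]

lemma HasAbsSum.hasFPowerSeriesOnBall {p : PowerSeries ℂ} {F : ℂ → ℂ} (hp : HasAbsSum p F) :
    HasFPowerSeriesOnBall F (FormalMultilinearSeries.ofScalars ℂ fun n => coeff n p) 0 1 where
  r_le := by
    refine ENNReal.le_of_forall_nnreal_lt fun r hr => ?_
    refine FormalMultilinearSeries.le_radius_of_summable_norm _ ?_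
    have hr' : ‖((r : ℝ) : ℂ)‖ < 1 := by simpa using hr
    refine (hp _ hr').1.congr fun n => ?_
    simp
  r_pos := one_pos
  hasSum := by
    intro z hz
    obtain ⟨s, t⟩ := hp z ((mem_eball_zero_one_iff z).1 hz)
    have := s.of_norm.hasSum
    rw [t] at this
    simpa [FormalMultilinearSeries.ofScalars_apply_eq, mul_comm] using this

lemma hasAbsSum_binomSeries (a : ℝ) {u : ℂ} (hu : ‖u‖ ≤ 1) :
    HasAbsSum (binomSeries a u) fun z => 1 / (1 - u * z) ^ (a : ℂ) := by
  intro z hz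
  have h := Complex.one_div_one_sub_cpow_hasFPowerSeriesOnBall_zero (a : ℂ)
  simp_rw [ringChoose_eq_risingCoeff] at h
  have huz : ‖u * z‖ < 1 := by
    rw [norm_mul]
    exact (mul_le_of_le_one_left (norm_nonneg _) hu).trans_lt hz
  have hmem : u * z ∈ Metric.eball (0 : ℂ) 1 := (mem_eball_zero_one_iff _).2 huz
  have key (n : ℕ) : coeff n (binomSeries a u) * z ^ n
      = FormalMultilinearSeries.ofScalars ℂ (fun n => (risingCoeff a n : ℂ)) n
        fun _ => u * z := by
    simp [binomSeries, mul_pow]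
    ring
  simp_rw [key]
  exact ⟨FormalMultilinearSeries.summable_norm_apply _ (Metric.eball_subset_eball h.r_le hmem), by
    simpa using (h.hasSum hmem).tsum_eq⟩

/-- Cauchy's estimate in `L¹` form. -/
lemma HasAbsSum.norm_coeff_le {p : PowerSeries ℂ} {F : ℂ → ℂ} (hp : HasAbsSum p F) {R : ℝ}
    (hR : 0 < R) (hR1 : R < 1) (n : ℕ) :
    ‖coeff n p‖ ≤ ((2 * π)⁻¹ * ∫ θ in (0 : ℝ)..2 * π, ‖F (circleMap 0 R θ)‖) * R⁻¹ ^ n := by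
  have h := hp.hasFPowerSeriesOnBall
  lift R to ℝ≥0 using hR.le
  have hd : DifferentiableOn ℂ F (Metric.closedBall 0 R) := by
    refine h.differentiableOn.mono fun z hz => ?_
    have : ‖z‖ < 1 := lt_of_le_of_lt (by simpa using hz) hR1
    exact (mem_eball_zero_one_iff z).2 this
  have h' := hd.hasFPowerSeriesOnBall (by exact_mod_cast hR)
  have he := h.hasFPowerSeriesAt.eq_formalMultilinearSeries h'.hasFPowerSeriesAt
  have hb := norm_cauchyPowerSeries_le F 0 R n
  rw [← he, FormalMultilinearSeries.ofScalars_norm, abs_of_pos hR] at hb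
  exact hb

end CoefficientBound

section CesaroNumbers

lemma cesaroA_eq_risingCoeff {α : ℝ} (hα : -1 < α) (n : ℕ) :
    cesaroA α n = risingCoeff (α + 1) n := by
  have hg : Real.Gamma (α + 1) ≠ 0 := (Real.Gamma_pos_of_pos (by linarith)).ne'
  induction n with
  | zero => simp [cesaroA, risingCoeff_zero, hg]
  | succ n ih =>
    have hn : (n : ℝ) + 1 ≠ 0 := by positivity
    apply mul_left_cancel₀ hn
    rw [succ_mul_risingCoeff, ← ih, cesaroA, cesaroA, Nat.factorial_succ]
    have h1 : α + n + 1 ≠ 0 := by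
      have : (0 : ℝ) ≤ n := n.cast_nonneg
      linarith
    have h2 := Real.Gamma_add_one h1
    have h3 : (n.factorial : ℝ) ≠ 0 := by exact_mod_cast n.factorial_ne_zero
    push_cast
    rw [show α + ((n : ℝ) + 1) + 1 = α + n + 1 + 1 by ring, h2]
    field_simp
    ring

lemma risingCoeff_pos {a : ℝ} (ha : 0 < a) (n : ℕ) : 0 < risingCoeff a n :=
  Finset.prod_pos fun _ _ => by positivity

lemma exists_inv_cesaroA_le {α : ℝ} (hα : 0 < α) :
    ∃ C : ℝ, 0 ≤ C ∧ ∀ n : ℕ, 1 ≤ n → (cesaroA α n)⁻¹ ≤ C * (1 / ((n : ℝ) + 1)) ^ α := by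
  obtain ⟨M, hM⟩ := (Real.GammaSeq_tendsto_Gamma (α + 1)).bddAbove_range
  have hM' (n : ℕ) : Real.GammaSeq (α + 1) n ≤ M := hM ⟨n, rfl⟩
  have hM0 : 0 ≤ M := le_trans (by rw [Real.GammaSeq]; positivity) (hM' 0)
  refine ⟨M * (α + 2) * 2 ^ α, by positivity, fun n hn => ?_⟩
  have hn0 : (1 : ℝ) ≤ n := by exact_mod_cast hn
  have hnp : (0 : ℝ) < n := by linarith
  have hprod : ∏ j ∈ Finset.range n, ((j : ℝ) + 1) = n.factorial := by
    exact_mod_cast Finset.prod_range_add_one_eq_factorial n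
  have hpos : 0 < ∏ j ∈ Finset.range n, (α + 1 + (j : ℝ)) :=
    Finset.prod_pos fun _ _ => by positivity
  have hA : (cesaroA α n)⁻¹ = Real.GammaSeq (α + 1) n * ((α + 1 + n) / n) * (n : ℝ) ^ (-α) := by
    have hf : (n.factorial : ℝ) ≠ 0 := by exact_mod_cast n.factorial_ne_zero
    have hnα : (n : ℝ) ^ α ≠ 0 := (Real.rpow_pos_of_pos hnp _).ne'
    rw [cesaroA_eq_risingCoeff (by linarith), risingCoeff, Finset.prod_div_distrib, hprod,
      Real.GammaSeq, Finset.prod_range_succ, Real.rpow_add_one hnp.ne', Real.rpow_neg hnp.le]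
    have h1 : α + 1 + n ≠ 0 := by positivity
    have h2 := hpos.ne'
    field_simp
  have h1 : (α + 1 + n) / n ≤ α + 2 := by
    rw [div_le_iff₀ hnp]; nlinarith
  have h2 : (n : ℝ) ^ (-α) ≤ 2 ^ α * (1 / ((n : ℝ) + 1)) ^ α := by
    rw [← Real.mul_rpow (by norm_num) (by positivity), Real.rpow_neg hnp.le,
      ← Real.inv_rpow hnp.le]
    refine Real.rpow_le_rpow (by positivity) ?_ hα.le
    rw [mul_one_div, inv_eq_one_div, div_le_div_iff₀ hnp (by positivity)]
    linarith
  rw [hA]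
  calc _ ≤ M * (α + 2) * (2 ^ α * (1 / ((n : ℝ) + 1)) ^ α) := by
        have := hM' n
        gcongr
    _ = _ := by ring

end CesaroNumbers

section KernelCoefficient

open PowerSeries

lemma coeff_cesaro_gegenbauer {α : ℝ} (hα : -1 < α) (μ t : ℝ) {u v : ℂ} (huv : u * v = 1)
    (ht : u + v = 2 * t) (n : ℕ) :
    coeff n (binomSeries (α + 1) 1 * ((1 - X * X) * (binomSeries μ u * binomSeries μ v)))
      = ((∑ k ∈ Finset.range (n + 1), cesaroA α (n - k)
          * (gegenbauer μ t 1 (k + 2) - gegenbauer μ t 1 k) : ℝ) : ℂ) := by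
  rw [mul_comm (binomSeries (α + 1) 1), coeff_mul,
    Finset.Nat.sum_antidiagonal_eq_sum_range_succ_mk]
  push_cast
  refine Finset.sum_congr rfl fun k _ => ?_
  rw [cesaroA_eq_risingCoeff hα, mul_comm]
  congr 1
  · simp [binomSeries]
  · rw [sub_mul, one_mul, map_sub, coeff_binomSeries_mul μ t huv ht, mul_assoc]
    congr 1
    match k with
    | 0 => simp [gegenbauer]
    | 1 => rw [coeff_succ_X_mul]; simp [gegenbauer]
    | k + 2 => rw [coeff_succ_X_mul, coeff_succ_X_mul, coeff_binomSeries_mul μ t huv ht]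

lemma norm_one_sub_mul_eq {u v z : ℂ} (huv : u * v = 1) (hu : ‖u‖ = 1) :
    ‖1 - u * z‖ = ‖v - z‖ := by
  rw [← huv, ← mul_sub, norm_mul, hu, one_mul]

lemma abs_cesaro_gegenbauer_le {α μ t : ℝ} (hα : 0 < α) {u v : ℂ}
    (huv : u * v = 1) (ht : u + v = 2 * t) (hu : ‖u‖ = 1) (hv : ‖v‖ = 1) {R : ℝ}
    (hR : 0 < R) (hR1 : R < 1) (n : ℕ) :
    |∑ k ∈ Finset.range (n + 1), cesaroA α (n - k)
        * (gegenbauer μ t 1 (k + 2) - gegenbauer μ t 1 k)|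
      ≤ (∫ θ in (0 : ℝ)..2 * π, ‖1 - circleMap 0 R θ‖ ^ (-α) *
          ‖u - circleMap 0 R θ‖ ^ (-μ) * ‖v - circleMap 0 R θ‖ ^ (-μ)) * R⁻¹ ^ n := by
  have hsum := (hasAbsSum_binomSeries (α + 1) (u := 1) (by simp)).mul
    ((hasAbsSum_one.sub (hasAbsSum_X.mul hasAbsSum_X)).mul
    ((hasAbsSum_binomSeries μ hu.le).mul (hasAbsSum_binomSeries μ hv.le)))
  have h := hsum.norm_coeff_le hR hR1 n
  rw [coeff_cesaro_gegenbauer (by linarith) μ t huv ht, Complex.norm_real, Real.norm_eq_abs] at h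
  refine h.trans (mul_le_mul_of_nonneg_right ?_ (by positivity))
  have hne (w : ℂ) (hw : ‖w‖ = 1) (θ : ℝ) : ‖w - circleMap 0 R θ‖ ≠ 0 := by
    rw [norm_ne_zero_iff, sub_ne_zero]
    rintro rfl
    rw [norm_circleMap_zero, abs_of_pos hR] at hw
    linarith
  have hcont (w : ℂ) (hw : ‖w‖ = 1) (b : ℝ) :
      Continuous fun θ => ‖w - circleMap 0 R θ‖ ^ b :=
    (continuous_const.sub (continuous_circleMap 0 R)).norm.rpow_const
      fun θ => Or.inl (hne w hw θ)
  have hpt (θ : ℝ) : ‖1 / (1 - 1 * circleMap 0 R θ) ^ ((α + 1 : ℝ) : ℂ) *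
      ((1 - circleMap 0 R θ * circleMap 0 R θ) * (1 / (1 - u * circleMap 0 R θ) ^ (μ : ℂ) *
        (1 / (1 - v * circleMap 0 R θ) ^ (μ : ℂ))))‖
      = ‖1 + circleMap 0 R θ‖ * (‖1 - circleMap 0 R θ‖ ^ (-α) *
          ‖u - circleMap 0 R θ‖ ^ (-μ) * ‖v - circleMap 0 R θ‖ ^ (-μ)) := by
    have h1 := norm_one_sub_mul_eq (z := circleMap 0 R θ) huv hu
    have h2 := norm_one_sub_mul_eq (z := circleMap 0 R θ) (by rw [mul_comm, huv] : v * u = 1) hv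
    have h0 := hne 1 (by simp) θ
    rw [norm_mul, norm_mul, norm_mul, norm_div, norm_div, norm_div, Complex.norm_cpow_real,
      Complex.norm_cpow_real, Complex.norm_cpow_real, h1, h2, one_mul, norm_one,
      Real.rpow_add_one h0, Real.rpow_neg (norm_nonneg _), Real.rpow_neg (norm_nonneg _),
      Real.rpow_neg (norm_nonneg _), show 1 - circleMap 0 R θ * circleMap 0 R θ
        = (1 - circleMap 0 R θ) * (1 + circleMap 0 R θ) by ring, norm_mul]
    field_simp
  have hbound (θ : ℝ) : ‖1 + circleMap 0 R θ‖ ≤ 2 := by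
    refine (norm_add_le _ _).trans ?_
    rw [norm_circleMap_zero, abs_of_pos hR, norm_one]
    linarith
  simp_rw [hpt]
  set G : ℝ → ℝ := fun θ => ‖1 - circleMap 0 R θ‖ ^ (-α) *
      ‖u - circleMap 0 R θ‖ ^ (-μ) * ‖v - circleMap 0 R θ‖ ^ (-μ) with hG
  have hGc : Continuous G :=
    ((hcont 1 (by simp) _).mul (hcont u hu _)).mul (hcont v hv _)
  have hG0 (θ : ℝ) : 0 ≤ G θ := by positivity
  have hle : ∫ θ in (0 : ℝ)..2 * π, ‖1 + circleMap 0 R θ‖ * G θ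
      ≤ ∫ θ in (0 : ℝ)..2 * π, 2 * G θ := by
    refine intervalIntegral.integral_mono_on (by positivity) ?_ ?_ fun θ _ =>
      mul_le_mul_of_nonneg_right (hbound θ) (hG0 θ)
    · exact ((continuous_const.add (continuous_circleMap 0 R)).norm.mul hGc).intervalIntegrable _ _
    · exact (continuous_const.mul hGc).intervalIntegrable _ _
  have hI : 0 ≤ ∫ θ in (0 : ℝ)..2 * π, G θ :=
    intervalIntegral.integral_nonneg (by positivity) fun θ _ => hG0 θ
  rw [intervalIntegral.integral_const_mul] at hle
  have hpi : (2 * π)⁻¹ * 2 ≤ 1 := by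
    rw [mul_inv, mul_right_comm, inv_mul_cancel₀ (by norm_num), one_mul]
    exact inv_le_one_of_one_le₀ (by linarith [Real.pi_gt_three])
  calc _ ≤ (2 * π)⁻¹ * (2 * ∫ θ in (0 : ℝ)..2 * π, G θ) :=
        mul_le_mul_of_nonneg_left hle (by positivity)
    _ = ((2 * π)⁻¹ * 2) * ∫ θ in (0 : ℝ)..2 * π, G θ := by ring
    _ ≤ _ := mul_le_of_le_one_left hI hpi

end KernelCoefficient

section CircleEstimate

lemma add_abs_le_pi_mul_norm {s φ : ℝ} (hs2 : s ≤ 1 / 2) (hφ : |φ| ≤ π) :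
    s + |φ| ≤ π * ‖1 - circleMap 0 (1 - s) φ‖ := by
  have hpi := Real.pi_gt_three
  have hsq : ‖1 - circleMap 0 (1 - s) φ‖ ^ 2
      = s ^ 2 + 4 * (1 - s) * Real.sin (φ / 2) ^ 2 := by
    have hc : Real.cos φ = 1 - 2 * Real.sin (φ / 2) ^ 2 := by
      have := Real.cos_two_mul (φ / 2)
      rw [mul_div_cancel₀ φ two_ne_zero] at this
      rw [this, Real.cos_sq']; ring
    have hcs := Real.sin_sq_add_cos_sq φ
    rw [← Complex.normSq_eq_norm_sq, Complex.normSq_apply, circleMap, zero_add,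
      Complex.exp_mul_I, ← Complex.ofReal_cos, ← Complex.ofReal_sin]
    simp [-Complex.ofReal_cos, -Complex.ofReal_sin]
    linear_combination (1 - s) ^ 2 * hcs - 2 * (1 - s) * hc
  have hsin : |φ| ≤ π * |Real.sin (φ / 2)| := by
    have h := Real.mul_abs_le_abs_sin (x := φ / 2) (by rw [abs_div, abs_two]; linarith)
    rw [abs_div, abs_two] at h
    have h2 : 2 / π * (|φ| / 2) = |φ| / π := by ring
    rw [h2, div_le_iff₀ (by positivity)] at h
    linarith
  have hsin2 : |φ| ^ 2 ≤ π ^ 2 * Real.sin (φ / 2) ^ 2 := by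
    rw [← sq_abs (Real.sin _), ← mul_pow]
    exact pow_le_pow_left₀ (abs_nonneg _) hsin 2
  refine abs_le_of_sq_le_sq' ?_ (by positivity) |>.2
  rw [mul_pow, hsq]
  have h1 : (s + |φ|) ^ 2 ≤ 2 * s ^ 2 + 2 * |φ| ^ 2 := by nlinarith [sq_nonneg (s - |φ|)]
  have h2 : π ^ 2 * Real.sin (φ / 2) ^ 2 * 2 ≤ π ^ 2 * Real.sin (φ / 2) ^ 2 * (4 * (1 - s)) :=
    mul_le_mul_of_nonneg_left (by linarith) (by positivity)
  have h3 : 2 * s ^ 2 ≤ π ^ 2 * s ^ 2 := mul_le_mul_of_nonneg_right (by nlinarith) (sq_nonneg s)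
  linarith

lemma continuous_norm_sub_circleMap_rpow {w : ℂ} (hw : ‖w‖ = 1) {R : ℝ} (hR : 0 < R)
    (hR1 : R < 1) (b : ℝ) : Continuous fun θ => ‖w - circleMap 0 R θ‖ ^ b := by
  refine (continuous_const.sub (continuous_circleMap 0 R)).norm.rpow_const
    fun θ => Or.inl (norm_ne_zero_iff.2 (sub_ne_zero.2 ?_))
  rintro rfl
  rw [norm_circleMap_zero, abs_of_pos hR] at hw
  linarith

lemma integral_norm_sub_circleMap_rpow_eq {w : ℂ} (hw : ‖w‖ = 1) (R b : ℝ) :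
    ∫ θ in (0 : ℝ)..2 * π, ‖w - circleMap 0 R θ‖ ^ b
      = ∫ θ in -π..π, ‖1 - circleMap 0 R θ‖ ^ b := by
  obtain ⟨ψ, rfl⟩ : ∃ ψ : ℝ, circleMap 0 1 ψ = w := by
    refine ⟨Complex.arg w, ?_⟩
    have := Complex.norm_mul_exp_arg_mul_I w
    rw [hw] at this
    rw [circleMap, zero_add]
    exact_mod_cast this
  have h (θ : ℝ) : ‖circleMap 0 1 ψ - circleMap 0 R θ‖ = ‖1 - circleMap 0 R (θ - ψ)‖ := by
    have : circleMap 0 1 ψ - circleMap 0 R θ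
        = circleMap 0 1 ψ * (1 - circleMap 0 R (θ - ψ)) := by
      simp only [circleMap, zero_add, Complex.ofReal_one, one_mul, mul_sub, mul_one,
        Complex.ofReal_sub, sub_mul, Complex.exp_sub]
      have := Complex.exp_ne_zero (ψ * Complex.I)
      field_simp
    rw [this, norm_mul, norm_circleMap_zero, abs_one, one_mul]
  simp_rw [h]
  rw [intervalIntegral.integral_comp_sub_right (fun θ => ‖1 - circleMap 0 R θ‖ ^ b) ψ]
  have hp : Function.Periodic (fun θ => ‖1 - circleMap 0 R θ‖ ^ b) (2 * π) := fun θ => by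
    simp only [periodic_circleMap 0 R θ]
  have := hp.intervalIntegral_add_eq (0 - ψ) (-π)
  rwa [show 0 - ψ + 2 * π = 2 * π - ψ by ring, show -π + 2 * π = π by ring] at this

lemma integral_norm_sub_circleMap_rpow_le {β : ℝ} (hβ : 1 < β) {s : ℝ} (hs : 0 < s)
    (hs2 : s ≤ 1 / 2) {w : ℂ} (hw : ‖w‖ = 1) :
    ∫ θ in (0 : ℝ)..2 * π, ‖w - circleMap 0 (1 - s) θ‖ ^ (-β)
      ≤ 2 * π ^ β / (β - 1) * s ^ (1 - β) := by
  rw [integral_norm_sub_circleMap_rpow_eq hw]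
  have hpi := Real.pi_pos
  have hc : Continuous fun φ : ℝ => (s + |φ|) ^ (-β) :=
    (continuous_const.add continuous_abs).rpow_const fun φ =>
      Or.inl (by positivity : s + |φ| ≠ 0)
  have h1 : ∫ θ in -π..π, ‖1 - circleMap 0 (1 - s) θ‖ ^ (-β)
      ≤ ∫ θ in -π..π, π ^ β * (s + |θ|) ^ (-β) := by
    refine intervalIntegral.integral_mono_on (by linarith)
      ((continuous_norm_sub_circleMap_rpow (by simp) (by linarith) (by linarith) _)
        |>.intervalIntegrable _ _) ((continuous_const.mul hc).intervalIntegrable _ _)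
      fun φ hφ => ?_
    have h := add_abs_le_pi_mul_norm hs2 (abs_le.2 hφ)
    have hpos : 0 < s + |φ| := by positivity
    calc _ = π ^ β * (π * ‖1 - circleMap 0 (1 - s) φ‖) ^ (-β) := by
          rw [Real.mul_rpow hpi.le (norm_nonneg _), ← mul_assoc, ← Real.rpow_add hpi,
            add_neg_cancel, Real.rpow_zero, one_mul]
      _ ≤ _ := mul_le_mul_of_nonneg_left
          (Real.rpow_le_rpow_of_nonpos hpos h (by linarith)) (by positivity)
  have h2 : ∫ θ in (0 : ℝ)..π, (s + |θ|) ^ (-β) ≤ s ^ (1 - β) / (β - 1) := by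
    have e : ∫ θ in (0 : ℝ)..π, (s + |θ|) ^ (-β) = ∫ θ in (0 : ℝ)..π, (s + θ) ^ (-β) := by
      refine intervalIntegral.integral_congr fun θ hθ => ?_
      rw [Set.uIcc_of_le hpi.le] at hθ
      simp only [abs_of_nonneg hθ.1]
    rw [e, intervalIntegral.integral_comp_add_left (fun x => x ^ (-β)),
      integral_rpow (Or.inr ⟨by linarith, fun h => ?_⟩)]
    · have hp : 0 ≤ (s + π) ^ (-β + 1) := by positivity
      have : ((s + π) ^ (-β + 1) - (s + 0) ^ (-β + 1)) / (-β + 1)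
          = (s ^ (1 - β) - (s + π) ^ (-β + 1)) / (β - 1) := by
        rw [add_zero, show (1 - β) = -β + 1 by ring, show (β - 1) = -(-β + 1) by ring, div_neg]
        ring
      rw [this]
      exact div_le_div_of_nonneg_right (by linarith) (by linarith)
    · rw [Set.uIcc_of_le (by linarith)] at h
      linarith [h.1]
  have h3 : ∫ θ in -π..(0 : ℝ), (s + |θ|) ^ (-β) = ∫ θ in (0 : ℝ)..π, (s + |θ|) ^ (-β) := by
    have := intervalIntegral.integral_comp_neg (fun θ => (s + |θ|) ^ (-β)) (a := 0) (b := π)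
    simp only [abs_neg, neg_zero] at this
    exact this.symm
  refine h1.trans ?_
  rw [intervalIntegral.integral_const_mul,
    ← intervalIntegral.integral_add_adjacent_intervals (hc.intervalIntegrable _ 0)
      (hc.intervalIntegrable _ _), h3]
  calc _ ≤ π ^ β * (s ^ (1 - β) / (β - 1) + s ^ (1 - β) / (β - 1)) := by gcongr
    _ = _ := by ring

lemma rpow_neg_le_of_le {q d b : ℝ} (hq : 0 < q) (h : q ≤ d) (hb : 0 ≤ b) :
    d ^ (-b) ≤ q ^ (-b) :=
  Real.rpow_le_rpow_of_nonpos hq h (by linarith)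

/-- If at most one of three positive numbers is smaller than `q`, their product of negative
powers is dominated by a sum in which only one singular factor remains. -/
lemma rpow_mul_rpow_mul_rpow_le {α μ β q d₀ d₁ d₂ : ℝ} (hα : 0 ≤ α) (hμ : 0 ≤ μ) (hβ : α ≤ β)
    (hq : 0 < q) (h₀ : 0 < d₀) (h₁ : 0 < d₁) (h₂ : 0 < d₂)
    (h₀₁ : q ≤ d₀ ∨ q ≤ d₁) (h₀₂ : q ≤ d₀ ∨ q ≤ d₂) (h₁₂ : q ≤ d₁ ∨ q ≤ d₂) :
    d₀ ^ (-α) * d₁ ^ (-μ) * d₂ ^ (-μ)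
      ≤ q ^ (β - α - 2 * μ) * d₀ ^ (-β) + q ^ (-α - μ) * (d₁ ^ (-μ) + d₂ ^ (-μ)) := by
  have e1 : q ^ (-α - μ) = q ^ (-α) * q ^ (-μ) := by rw [← Real.rpow_add hq]; ring_nf
  have e2 : q ^ (β - α - 2 * μ) = q ^ (β - α) * q ^ (-μ) * q ^ (-μ) := by
    rw [← Real.rpow_add hq, ← Real.rpow_add hq]; ring_nf
  have p0 := Real.rpow_pos_of_pos h₀ (-β)
  have p1 := Real.rpow_pos_of_pos h₁ (-μ)
  have p2 := Real.rpow_pos_of_pos h₂ (-μ)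
  have pq1 := Real.rpow_pos_of_pos hq (-α - μ)
  have pq2 := Real.rpow_pos_of_pos hq (β - α - 2 * μ)
  have pqα := Real.rpow_pos_of_pos hq (-α)
  have pqμ := Real.rpow_pos_of_pos hq (-μ)
  by_cases hd : q ≤ d₀
  · have a0 := rpow_neg_le_of_le hq hd hα
    have a0' := Real.rpow_pos_of_pos h₀ (-α)
    have step : d₀ ^ (-α) * d₁ ^ (-μ) * d₂ ^ (-μ)
        ≤ q ^ (-α - μ) * (d₁ ^ (-μ) + d₂ ^ (-μ)) := by
      rw [e1]
      rcases h₁₂ with h | h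
      · have a1 := rpow_neg_le_of_le hq h hμ
        calc _ ≤ q ^ (-α) * q ^ (-μ) * d₂ ^ (-μ) := by gcongr
          _ ≤ _ := by gcongr; linarith
      · have a1 := rpow_neg_le_of_le hq h hμ
        calc _ ≤ q ^ (-α) * d₁ ^ (-μ) * q ^ (-μ) := by gcongr
          _ = q ^ (-α) * q ^ (-μ) * d₁ ^ (-μ) := by ring
          _ ≤ _ := by gcongr; linarith
    have := mul_pos pq2 p0
    linarith
  · have a1 := rpow_neg_le_of_le hq (h₀₁.resolve_left hd) hμ
    have a2 := rpow_neg_le_of_le hq (h₀₂.resolve_left hd) hμ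
    have a0 : d₀ ^ (-α) ≤ q ^ (β - α) * d₀ ^ (-β) := by
      have : d₀ ^ (-α) = d₀ ^ (β - α) * d₀ ^ (-β) := by
        rw [← Real.rpow_add h₀]; ring_nf
      rw [this]
      gcongr
      linarith
    have := mul_pos pq1 (add_pos p1 p2)
    calc _ ≤ q ^ (β - α) * d₀ ^ (-β) * q ^ (-μ) * q ^ (-μ) := by gcongr
      _ = q ^ (β - α - 2 * μ) * d₀ ^ (-β) := by rw [e2]; ring
      _ ≤ _ := by linarith

end CircleEstimate

section KernelEstimate

lemma integral_norm_rpow_mul_le {α μ β s η : ℝ} (hα : 0 ≤ α) (hμ : 1 < μ) (hβ : α ≤ β)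
    (hβ1 : 1 < β) (hs : 0 < s) (hs2 : s ≤ 1 / 2) {u v : ℂ} (hu : ‖u‖ = 1) (hv : ‖v‖ = 1)
    (hη : 0 ≤ η) (h1u : η ≤ ‖1 - u‖) (h1v : η ≤ ‖1 - v‖) (huv : η ≤ ‖u - v‖) :
    ∫ θ in (0 : ℝ)..2 * π, ‖1 - circleMap 0 (1 - s) θ‖ ^ (-α) *
        ‖u - circleMap 0 (1 - s) θ‖ ^ (-μ) * ‖v - circleMap 0 (1 - s) θ‖ ^ (-μ)
      ≤ ((s + η) / 4) ^ (β - α - 2 * μ) * (2 * π ^ β / (β - 1) * s ^ (1 - β))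
        + ((s + η) / 4) ^ (-α - μ) * (2 * (2 * π ^ μ / (μ - 1) * s ^ (1 - μ))) := by
  have hR : 0 < 1 - s := by linarith
  have hR1 : 1 - s < 1 := by linarith
  have hc {w : ℂ} (hw : ‖w‖ = 1) (b : ℝ) := continuous_norm_sub_circleMap_rpow hw hR hR1 b
  have h1 : ‖(1 : ℂ)‖ = 1 := by simp
  have hlow {w : ℂ} (hw : ‖w‖ = 1) (θ : ℝ) : s ≤ ‖w - circleMap 0 (1 - s) θ‖ := by
    have := norm_sub_norm_le w (circleMap 0 (1 - s) θ)
    rw [hw, norm_circleMap_zero, abs_of_pos hR] at this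
    linarith
  have hsep {w w' : ℂ} (hw : ‖w‖ = 1) (hw' : ‖w'‖ = 1) (h : η ≤ ‖w - w'‖) (θ : ℝ) :
      (s + η) / 4 ≤ ‖w - circleMap 0 (1 - s) θ‖ ∨
        (s + η) / 4 ≤ ‖w' - circleMap 0 (1 - s) θ‖ := by
    by_contra! hcon
    have a1 := hlow hw θ
    have a2 := hlow hw' θ
    have a3 := norm_sub_le_norm_sub_add_norm_sub w (circleMap 0 (1 - s) θ) w'
    rw [norm_sub_rev (circleMap 0 (1 - s) θ) w'] at a3
    linarith [hcon.1, hcon.2]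
  have i0 := ((hc h1 (-β)).intervalIntegrable (μ := volume) 0 (2 * π))
  have i1 := ((hc hu (-μ)).intervalIntegrable (μ := volume) 0 (2 * π))
  have i2 := ((hc hv (-μ)).intervalIntegrable (μ := volume) 0 (2 * π))
  have hle := intervalIntegral.integral_mono_on (μ := volume) (a := 0) (b := 2 * π)
    (by positivity) ((((hc h1 (-α)).mul (hc hu (-μ))).mul (hc hv (-μ))).intervalIntegrable _ _)
    ((i0.const_mul (((s + η) / 4) ^ (β - α - 2 * μ))).add
      ((i1.add i2).const_mul (((s + η) / 4) ^ (-α - μ))))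
    (fun θ _ => rpow_mul_rpow_mul_rpow_le (q := (s + η) / 4) hα (by linarith) hβ
      (by positivity) (hs.trans_le (hlow h1 θ)) (hs.trans_le (hlow hu θ))
      (hs.trans_le (hlow hv θ)) (hsep h1 hu h1u θ) (hsep h1 hv h1v θ) (hsep hu hv huv θ))
  refine hle.trans ?_
  rw [intervalIntegral.integral_add (i0.const_mul _) ((i1.add i2).const_mul _),
    intervalIntegral.integral_const_mul, intervalIntegral.integral_const_mul,
    intervalIntegral.integral_add i1 i2, two_mul (2 * π ^ μ / (μ - 1) * s ^ (1 - μ))]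
  have j0 := integral_norm_sub_circleMap_rpow_le hβ1 hs hs2 h1
  have j1 := integral_norm_sub_circleMap_rpow_le hμ hs hs2 hu
  have j2 := integral_norm_sub_circleMap_rpow_le hμ hs hs2 hv
  gcongr

lemma inv_one_sub_pow_le_exp {n : ℕ} (hn : 1 ≤ n) :
    (1 - 1 / ((n : ℝ) + 1))⁻¹ ^ n ≤ Real.exp 1 := by
  have hn0 : (0 : ℝ) < n := by exact_mod_cast hn
  have h : (1 - 1 / ((n : ℝ) + 1))⁻¹ = 1 / n + 1 := by
    rw [show 1 - 1 / ((n : ℝ) + 1) = n / (n + 1) by field_simp; ring]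
    field_simp
    ring
  rw [h]
  calc _ ≤ Real.exp (1 / n) ^ n := pow_le_pow_left₀ (by positivity) (Real.add_one_le_exp _) n
    _ = Real.exp 1 := by
      rw [← Real.exp_nat_mul, mul_one_div_cancel hn0.ne']

/-- The pointwise bound for the Cesàro kernel, in terms of `s = 1 / (n + 1)` and of the sine
`√(1 - t²)` of the geodesic distance. -/
lemma exists_abs_cesaro_gegenbauer_le {l α ε : ℝ} (hl : 0 < l) (hε : 0 < ε) (hε1 : ε ≤ 1)
    (hεα : ε ≤ α - l) :
    ∃ C : ℝ, 0 ≤ C ∧ ∀ n : ℕ, 1 ≤ n → ∀ t : ℝ, t ^ 2 ≤ 1 →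
      |(cesaroA α n)⁻¹ * ∑ k ∈ Finset.range (n + 1), cesaroA α (n - k)
        * (gegenbauer (l + 1) t 1 (k + 2) - gegenbauer (l + 1) t 1 k)|
      ≤ C * ((1 / ((n : ℝ) + 1)) ^ ε
          * (1 / ((n : ℝ) + 1) + √(1 - t ^ 2)) ^ (-(2 * l + 1 + ε))) := by
  have hα : 0 < α := by linarith
  obtain ⟨A, hA0, hA⟩ := exists_inv_cesaroA_le hα
  set β := α + 1 - ε with hβ
  set μ := l + 1 with hμ
  set e := 2 * l + 1 + ε with he
  have hβ1 : 1 < β := by linarith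
  have hμ1 : 1 < μ := by linarith
  set K₀ := 2 * π ^ β / (β - 1)
  set K₁ := 2 * π ^ μ / (μ - 1)
  have hpi := Real.pi_pos
  have hK₀ : 0 ≤ K₀ := div_nonneg (by positivity) (by linarith)
  have hK₁ : 0 ≤ K₁ := div_nonneg (by positivity) (by linarith)
  refine ⟨A * ((K₀ + 2 * K₁ * 4 ^ (α - l - ε)) * 4 ^ e) * Real.exp 1, by positivity,
    fun n hn t ht => ?_⟩
  have hn1 : (1 : ℝ) ≤ n := by exact_mod_cast hn
  have hApos : 0 < (cesaroA α n)⁻¹ := by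
    rw [cesaroA_eq_risingCoeff (by linarith)]
    exact inv_pos.2 (risingCoeff_pos (by linarith) n)
  have hAn := hA n hn
  have hexp := inv_one_sub_pow_le_exp hn
  set s : ℝ := 1 / ((n : ℝ) + 1) with hs
  have hs0 : 0 < s := by positivity
  have hs2 : s ≤ 1 / 2 := by
    rw [hs]; exact one_div_le_one_div_of_le (by norm_num) (by linarith)
  set η := √(1 - t ^ 2) with hη
  have hη0 : 0 ≤ η := Real.sqrt_nonneg _
  have hη2 : η ^ 2 = 1 - t ^ 2 := Real.sq_sqrt (by linarith)
  set u : ℂ := ⟨t, η⟩ with hu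
  set v : ℂ := ⟨t, -η⟩ with hv
  have huv : u * v = 1 := by
    apply Complex.ext <;> simp [u, v]
    · nlinarith
    · ring
  have hsum : u + v = 2 * t := by
    apply Complex.ext <;> simp [u, v]
    ring
  have nu : ‖u‖ = 1 := by
    rw [← sq_eq_sq₀ (norm_nonneg _) zero_le_one, ← Complex.normSq_eq_norm_sq,
      Complex.normSq_apply]
    simp only [u]; nlinarith
  have nv : ‖v‖ = 1 := by
    rw [← sq_eq_sq₀ (norm_nonneg _) zero_le_one, ← Complex.normSq_eq_norm_sq,
      Complex.normSq_apply]
    simp only [v]; nlinarith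
  have d1 : η ≤ ‖1 - u‖ := by
    have := Complex.abs_im_le_norm (1 - u)
    simpa [u, abs_of_nonneg hη0] using this
  have d2 : η ≤ ‖1 - v‖ := by
    have := Complex.abs_im_le_norm (1 - v)
    simpa [v, abs_of_nonneg hη0] using this
  have d3 : η ≤ ‖u - v‖ := by
    have := Complex.abs_im_le_norm (u - v)
    have h2 : (u - v).im = 2 * η := by simp [u, v]; ring
    rw [h2, abs_of_nonneg (by positivity)] at this
    linarith
  have hI := integral_norm_rpow_mul_le (η := η) hα.le hμ1 (by linarith : α ≤ β) hβ1 hs0 hs2 nu nv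
    hη0 d1 d2 d3
  have hS := abs_cesaro_gegenbauer_le (μ := μ) hα huv hsum nu nv (by linarith : 0 < 1 - s)
    (by linarith) n
  set q := (s + η) / 4 with hq
  have hq0 : 0 < q := by positivity
  have e1 : s ^ α * (q ^ (β - α - 2 * μ) * (K₀ * s ^ (1 - β))) = K₀ * (s ^ ε * q ^ (-e)) := by
    rw [show β - α - 2 * μ = -e by rw [hβ, hμ, he]; ring,
      show ε = α + (1 - β) by rw [hβ]; ring, Real.rpow_add hs0]
    ring
  have e2 : s ^ α * (q ^ (-α - μ) * (2 * (K₁ * s ^ (1 - μ))))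
      ≤ 2 * K₁ * 4 ^ (α - l - ε) * (s ^ ε * q ^ (-e)) := by
    have hsq : s ^ (α - l - ε) ≤ 4 ^ (α - l - ε) * q ^ (α - l - ε) := by
      rw [← Real.mul_rpow (by norm_num) hq0.le]
      exact Real.rpow_le_rpow hs0.le (by rw [hq]; linarith) (by linarith)
    have f1 : s ^ α * s ^ (1 - μ) = s ^ ε * s ^ (α - l - ε) := by
      rw [← Real.rpow_add hs0, ← Real.rpow_add hs0, hμ]; ring_nf
    have f2 : q ^ (α - l - ε) * q ^ (-α - μ) = q ^ (-e) := by
      rw [← Real.rpow_add hq0, hμ, he]; ring_nf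
    calc _ = 2 * K₁ * q ^ (-α - μ) * (s ^ α * s ^ (1 - μ)) := by ring
      _ = 2 * K₁ * q ^ (-α - μ) * s ^ ε * s ^ (α - l - ε) := by rw [f1]; ring
      _ ≤ 2 * K₁ * q ^ (-α - μ) * s ^ ε * (4 ^ (α - l - ε) * q ^ (α - l - ε)) := by gcongr
      _ = 2 * K₁ * 4 ^ (α - l - ε) * (s ^ ε * (q ^ (α - l - ε) * q ^ (-α - μ))) := by ring
      _ = _ := by rw [f2]
  have e3 : q ^ (-e) = 4 ^ e * (s + η) ^ (-e) := by
    rw [hq, Real.div_rpow (by positivity) (by norm_num), Real.rpow_neg (by norm_num : (0:ℝ) ≤ 4),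
      div_inv_eq_mul, mul_comm]
  set J := ∫ θ in (0 : ℝ)..2 * π, ‖1 - circleMap 0 (1 - s) θ‖ ^ (-α) *
        ‖u - circleMap 0 (1 - s) θ‖ ^ (-μ) * ‖v - circleMap 0 (1 - s) θ‖ ^ (-μ)
  have hJ : 0 ≤ J := intervalIntegral.integral_nonneg (by positivity) fun θ _ => by positivity
  rw [abs_mul, abs_of_pos hApos]
  calc _ ≤ A * s ^ α * (J * Real.exp 1) := by
        refine mul_le_mul hAn (hS.trans ?_) (abs_nonneg _) (by positivity)
        gcongr
    _ = A * Real.exp 1 * (s ^ α * J) := by ring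
    _ ≤ A * Real.exp 1 * (s ^ α * (q ^ (β - α - 2 * μ) * (K₀ * s ^ (1 - β))
        + q ^ (-α - μ) * (2 * (K₁ * s ^ (1 - μ))))) := by gcongr
    _ ≤ A * Real.exp 1 * (K₀ * (s ^ ε * q ^ (-e))
        + 2 * K₁ * 4 ^ (α - l - ε) * (s ^ ε * q ^ (-e))) := by
      rw [mul_add, e1]; gcongr
    _ = _ := by rw [e3]; ring

end KernelEstimate

section GaussianIntegral

variable {ι : Type*} [Fintype ι]

open MvPolynomial in
lemma hasFDerivAt_eval (P : MvPolynomial ι ℝ) (y : EuclideanSpace ℝ ι) :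
    HasFDerivAt (fun y : EuclideanSpace ℝ ι => eval (fun i => y i) P)
      (∑ i, eval (fun i => y i) (pderiv i P) • (EuclideanSpace.proj i : EuclideanSpace ℝ ι →L[ℝ] ℝ))
      y := by
  classical
  induction P using MvPolynomial.induction_on with
  | C a => simpa using hasFDerivAt_const a y
  | add p q hp hq =>
    simp only [map_add, add_smul, Finset.sum_add_distrib]
    exact hp.add hq
  | mul_X p j hp =>
    simp only [map_mul, eval_X]
    have hX : HasFDerivAt (fun y : EuclideanSpace ℝ ι => y j)
        (EuclideanSpace.proj j : EuclideanSpace ℝ ι →L[ℝ] ℝ) y :=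
      (EuclideanSpace.proj j : EuclideanSpace ℝ ι →L[ℝ] ℝ).hasFDerivAt
    refine (hp.mul hX).congr_fderiv ?_
    ext v
    simp [Derivation.leibniz, pderiv_X, Pi.single_apply, add_mul, Finset.sum_add_distrib,
      Finset.mul_sum, mul_assoc, apply_ite]

lemma continuous_eval_euclidean (P : MvPolynomial ι ℝ) :
    Continuous fun y : EuclideanSpace ℝ ι => MvPolynomial.eval (fun i => y i) P :=
  continuous_iff_continuousAt.2 fun y => (hasFDerivAt_eval P y).continuousAt

lemma integrable_norm_pow_mul_gaussian (m : ℕ) :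
    Integrable fun y : EuclideanSpace ℝ ι => ‖y‖ ^ m * rexp (-‖y‖ ^ 2 / 2) := by
  cases isEmpty_or_nonempty ι
  · exact Integrable.of_finite
  have := integrable_fun_norm_addHaar (volume : Measure (EuclideanSpace ℝ ι))
    (f := fun r => r ^ m * rexp (-r ^ 2 / 2))
  refine this.2 ?_
  have h := integrableOn_rpow_mul_exp_neg_mul_sq (b := 1 / 2) (by norm_num)
    (s := ((Module.finrank ℝ (EuclideanSpace ℝ ι) - 1 + m : ℕ) : ℝ))
    (by have : (0 : ℝ) ≤ ((Module.finrank ℝ (EuclideanSpace ℝ ι) - 1 + m : ℕ) : ℝ) :=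
          Nat.cast_nonneg _
        linarith)
  refine h.congr_fun (fun r _ => ?_) measurableSet_Ioi
  simp only [Real.rpow_natCast, smul_eq_mul, pow_add]
  rw [show -(1 / 2) * r ^ 2 = -r ^ 2 / 2 by ring]
  ring

lemma integrable_eval_mul_gaussian (P : MvPolynomial ι ℝ) :
    Integrable fun y : EuclideanSpace ℝ ι =>
      MvPolynomial.eval (fun i => y i) P * rexp (-‖y‖ ^ 2 / 2) := by
  induction P using MvPolynomial.induction_on' with
  | monomial s c =>
    have h := (integrable_norm_pow_mul_gaussian (ι := ι) (∑ i, s i)).const_mul |c|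
    refine h.mono' ?_ (ae_of_all _ fun y => ?_)
    · exact ((continuous_eval_euclidean _).mul (by fun_prop)).aestronglyMeasurable
    · rw [MvPolynomial.eval_monomial, Finsupp.prod_fintype _ _ (by simp), norm_mul, norm_mul,
        Real.norm_of_nonneg (Real.exp_nonneg _), Real.norm_eq_abs, norm_prod, mul_assoc,
        ← Finset.prod_pow_eq_pow_sum]
      gcongr with i
      rw [norm_pow]
      gcongr
      exact PiLp.norm_apply_le y i
  | add p q hp hq =>
    simp only [map_add, add_mul]
    exact hp.add hq

/-- The integral of a polynomial against the Gaussian weight. -/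
def gaussianIntegral (P : MvPolynomial ι ℝ) : ℝ :=
  ∫ y : EuclideanSpace ℝ ι, MvPolynomial.eval (fun i => y i) P * rexp (-‖y‖ ^ 2 / 2)

lemma gaussianIntegral_add (P Q : MvPolynomial ι ℝ) :
    gaussianIntegral (P + Q) = gaussianIntegral P + gaussianIntegral Q := by
  simp only [gaussianIntegral, map_add, add_mul]
  exact integral_add (integrable_eval_mul_gaussian P) (integrable_eval_mul_gaussian Q)

lemma gaussianIntegral_C_mul (c : ℝ) (P : MvPolynomial ι ℝ) :
    gaussianIntegral (MvPolynomial.C c * P) = c * gaussianIntegral P := by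
  simp only [gaussianIntegral, map_mul, MvPolynomial.eval_C, mul_assoc]
  exact integral_const_mul _ _

lemma gaussianIntegral_zero : gaussianIntegral (0 : MvPolynomial ι ℝ) = 0 := by
  simp [gaussianIntegral]

lemma gaussianIntegral_sum {κ : Type*} (s : Finset κ) (P : κ → MvPolynomial ι ℝ) :
    gaussianIntegral (∑ k ∈ s, P k) = ∑ k ∈ s, gaussianIntegral (P k) := by
  classical
  induction s using Finset.induction_on with
  | empty => simp [gaussianIntegral_zero]
  | insert a s ha ih => rw [Finset.sum_insert ha, Finset.sum_insert ha, gaussianIntegral_add, ih]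

open MvPolynomial in
lemma gaussianIntegral_X_mul (P : MvPolynomial ι ℝ) (i : ι) :
    gaussianIntegral (X i * P) = gaussianIntegral (pderiv i P) := by
  classical
  have hf (y : EuclideanSpace ℝ ι) : fderiv ℝ (fun y : EuclideanSpace ℝ ι =>
      eval (fun i => y i) P) y (EuclideanSpace.single i 1) = eval (fun i => y i) (pderiv i P) := by
    rw [(hasFDerivAt_eval P y).fderiv]
    simp
  have hg' (y : EuclideanSpace ℝ ι) : HasFDerivAt (fun y : EuclideanSpace ℝ ι =>
      rexp (-‖y‖ ^ 2 / 2)) (rexp (-‖y‖ ^ 2 / 2) • (-(innerSL ℝ y))) y := by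
    have h : HasFDerivAt (fun y : EuclideanSpace ℝ ι => -‖y‖ ^ 2 / 2) (-(innerSL ℝ y)) y := by
      have h1 := ((hasStrictFDerivAt_norm_sq y).hasFDerivAt).const_mul (-1 / 2 : ℝ)
      refine (h1.congr_fderiv ?_).congr_of_eventuallyEq (.of_forall fun z => by ring)
      ext v
      simp
      ring
    exact h.exp
  have hg (y : EuclideanSpace ℝ ι) : fderiv ℝ (fun y : EuclideanSpace ℝ ι =>
      rexp (-‖y‖ ^ 2 / 2)) y (EuclideanSpace.single i 1) = -(y i * rexp (-‖y‖ ^ 2 / 2)) := by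
    rw [(hg' y).fderiv]
    simp [EuclideanSpace.inner_single_right, mul_comm]
  have hXP := integrable_eval_mul_gaussian (X i * P)
  simp only [map_mul, eval_X] at hXP
  have h := integral_mul_fderiv_eq_neg_fderiv_mul_of_integrable
    (μ := (volume : Measure (EuclideanSpace ℝ ι)))
    (f := fun y : EuclideanSpace ℝ ι => eval (fun i => y i) P)
    (g := fun y => rexp (-‖y‖ ^ 2 / 2)) (v := EuclideanSpace.single i 1)
    (by simpa only [hf] using integrable_eval_mul_gaussian (pderiv i P))
    (by simp only [hg]; exact hXP.neg.congr (.of_forall fun y => by simp; ring))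
    (integrable_eval_mul_gaussian P)
    (fun y _ => (hasFDerivAt_eval P y).differentiableAt) (fun y _ => (hg' y).differentiableAt)
  simp only [hf, hg] at h
  simp only [gaussianIntegral, map_mul, eval_X]
  rw [← neg_inj, ← h, ← integral_neg]
  exact integral_congr_ae (.of_forall fun y => by ring)

end GaussianIntegral

section HarmonicPairing

open MvPolynomial

variable {ι : Type*} [Fintype ι]

lemma pderiv_pderiv_comm {κ : Type*} (i j : κ) (P : MvPolynomial κ ℝ) :
    pderiv i (pderiv j P) = pderiv j (pderiv i P) := by
  classical
  induction P using MvPolynomial.induction_on with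
  | C a => simp
  | add p q hp hq => simp [hp, hq]
  | mul_X p k hp =>
    have h (l : κ) : pderiv l (pderiv i (X k : MvPolynomial κ ℝ)) = 0 := by
      rw [pderiv_X, Pi.single_apply]; split_ifs <;> simp
    have h' (l : κ) : pderiv l (pderiv j (X k : MvPolynomial κ ℝ)) = 0 := by
      rw [pderiv_X, Pi.single_apply]; split_ifs <;> simp
    simp only [Derivation.leibniz, map_add, smul_eq_mul, hp, h, h']
    ring

lemma laplacian_directional {P : MvPolynomial ι ℝ}
    (hΔ : ∑ i, pderiv i (pderiv i P) = 0) (x : ι → ℝ) :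
    ∑ i, pderiv i (pderiv i (∑ j, C (x j) * pderiv j P)) = 0 := by
  classical
  have h (i : ι) : pderiv i (pderiv i (∑ j, C (x j) * pderiv j P))
      = ∑ j, C (x j) * pderiv j (pderiv i (pderiv i P)) := by
    simp only [map_sum, pderiv_C_mul]
    refine Finset.sum_congr rfl fun j _ => ?_
    rw [pderiv_pderiv_comm i j P, pderiv_pderiv_comm i j]
  simp_rw [h]
  rw [Finset.sum_comm]
  simp_rw [← Finset.mul_sum, ← map_sum, hΔ, map_zero, mul_zero, Finset.sum_const_zero]

lemma gaussianIntegral_sumSq_mul {P : MvPolynomial ι ℝ} {m : ℕ} (hP : P.IsHomogeneous m) :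
    gaussianIntegral (sumSq ι * P) = (Fintype.card ι + m) * gaussianIntegral P := by
  classical
  have h (i : ι) : gaussianIntegral (X i ^ 2 * P)
      = gaussianIntegral P + gaussianIntegral (X i * pderiv i P) := by
    rw [sq, mul_assoc, gaussianIntegral_X_mul, ← gaussianIntegral_add]
    congr 1
    simp [Derivation.leibniz]
    ring
  have hE := congrArg gaussianIntegral hP.sum_X_mul_pderiv
  rw [nsmul_eq_mul, ← C_eq_coe_nat, gaussianIntegral_C_mul, gaussianIntegral_sum] at hE
  rw [sumSq, Finset.sum_mul, gaussianIntegral_sum]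
  simp_rw [h]
  rw [Finset.sum_add_distrib, hE]
  simp
  ring

lemma natCast_mul_gaussianIntegral_harmonic_mul {P : MvPolynomial ι ℝ} {k : ℕ}
    (hP : P.IsHomogeneous k) (hΔ : ∑ i, pderiv i (pderiv i P) = 0) (x : ι → ℝ) (m : ℕ) :
    k * gaussianIntegral (P * linForm x ^ m)
      = m * gaussianIntegral ((∑ i, C (x i) * pderiv i P) * linForm x ^ (m - 1)) := by
  have h (i : ι) : gaussianIntegral (X i * (pderiv i P * linForm x ^ m))
      = gaussianIntegral (pderiv i (pderiv i P) * linForm x ^ m)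
        + m * gaussianIntegral (C (x i) * pderiv i P * linForm x ^ (m - 1)) := by
    rw [gaussianIntegral_X_mul, ← gaussianIntegral_C_mul, ← gaussianIntegral_add]
    congr 1
    rw [Derivation.leibniz, Derivation.leibniz_pow, pderiv_linForm]
    simp only [smul_eq_mul, nsmul_eq_mul, map_natCast]
    ring
  have hE := congrArg (fun Q => gaussianIntegral (Q * linForm x ^ m)) hP.sum_X_mul_pderiv
  simp only [nsmul_eq_mul, ← C_eq_coe_nat, Finset.sum_mul, mul_assoc, gaussianIntegral_C_mul,
    gaussianIntegral_sum] at hE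
  simp_rw [h] at hE
  rw [← hE, Finset.sum_add_distrib, ← gaussianIntegral_sum, ← Finset.sum_mul, hΔ, zero_mul,
    gaussianIntegral_zero, zero_add, ← Finset.mul_sum, ← gaussianIntegral_sum, ← Finset.sum_mul]

lemma eval_sum_C_mul_pderiv {P : MvPolynomial ι ℝ} {k : ℕ} (hP : P.IsHomogeneous k)
    (x : ι → ℝ) : eval x (∑ i, C (x i) * pderiv i P) = k * eval x P := by
  have := congrArg (eval x) hP.sum_X_mul_pderiv
  simpa using this

lemma gaussianIntegral_harmonic_mul_pow (x : ι → ℝ) (k : ℕ) {P : MvPolynomial ι ℝ}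
    (hP : P.IsHomogeneous k) (hΔ : ∑ i, pderiv i (pderiv i P) = 0) :
    (∀ m < k, gaussianIntegral (P * linForm x ^ m) = 0) ∧
      gaussianIntegral (P * linForm x ^ k)
        = k.factorial * eval x P * gaussianIntegral (1 : MvPolynomial ι ℝ) := by
  induction k generalizing P with
  | zero =>
    refine ⟨by simp, ?_⟩
    have hC : P = C (coeff 0 P) := totalDegree_eq_zero_iff_eq_C.1 (by
      simpa using hP.totalDegree_le)
    rw [hC]
    simpa using gaussianIntegral_C_mul (coeff 0 P) 1
  | succ k ih =>
    have hD : (∑ i, C (x i) * pderiv i P).IsHomogeneous k :=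
      IsHomogeneous.sum _ _ _ fun i _ => by
        simpa using (isHomogeneous_C ι (x i)).mul (hP.pderiv (i := i))
    obtain ⟨ih1, ih2⟩ := ih hD (laplacian_directional hΔ x)
    have hk : ((k + 1 : ℕ) : ℝ) ≠ 0 := by positivity
    refine ⟨fun m hm => ?_, ?_⟩
    · apply (mul_eq_zero.1 (_ : ((k + 1 : ℕ) : ℝ) * _ = 0)).resolve_left hk
      rw [natCast_mul_gaussianIntegral_harmonic_mul hP hΔ]
      rcases m with _ | m
      · simp
      · rw [Nat.add_sub_cancel, ih1 m (by omega), mul_zero]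
    · apply mul_left_cancel₀ hk
      rw [natCast_mul_gaussianIntegral_harmonic_mul hP hΔ, Nat.add_sub_cancel, ih2,
        eval_sum_C_mul_pderiv hP, Nat.factorial_succ]
      push_cast
      ring

lemma eval_linForm (x y : ι → ℝ) : eval y (linForm x) = ∑ i, x i * y i := by
  simp [linForm]

lemma eval_sumSq (y : EuclideanSpace ℝ ι) : eval (fun i => y i) (sumSq ι) = ‖y‖ ^ 2 := by
  simp [sumSq, EuclideanSpace.norm_sq_eq]

/-- The radial moment of order `m` of the Gaussian weight. -/
def gaussianMoment (ι : Type*) [Fintype ι] (m : ℕ) : ℝ :=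
  ∫ y : EuclideanSpace ℝ ι, ‖y‖ ^ m * rexp (-‖y‖ ^ 2 / 2)

lemma gaussianMoment_pos [Nonempty ι] (m : ℕ) : 0 < gaussianMoment ι m := by
  classical
  obtain ⟨i⟩ := ‹Nonempty ι›
  refine integral_pos_of_integrable_nonneg_nonzero (x := EuclideanSpace.single i 1)
    (by fun_prop) (integrable_norm_pow_mul_gaussian m) (fun y => by positivity) ?_
  simp

lemma gaussianMoment_two_mul_add_two (k : ℕ) :
    gaussianMoment ι (2 * (k + 1)) = (Fintype.card ι + 2 * k) * gaussianMoment ι (2 * k) := by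
  have h (k : ℕ) : gaussianMoment ι (2 * k) = gaussianIntegral (sumSq ι ^ k) := by
    simp only [gaussianMoment, gaussianIntegral, map_pow, eval_sumSq, pow_mul]
  rw [h, h, pow_succ', gaussianIntegral_sumSq_mul (isHomogeneous_sumSq.pow k)]
  push_cast
  ring

lemma integral_homogeneous_mul_gaussian {m : ℕ} {h : EuclideanSpace ℝ ι → ℝ}
    (hh : ∀ r : ℝ, 0 < r → ∀ y, h (r • y) = r ^ m * h y) [Nontrivial (EuclideanSpace ℝ ι)] :
    ∫ y, h y * rexp (-‖y‖ ^ 2 / 2)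
      = (∫ w, h w ∂(volume : Measure (EuclideanSpace ℝ ι)).toSphere)
        * ∫ r : Set.Ioi (0 : ℝ), r.1 ^ m * rexp (-r.1 ^ 2 / 2)
          ∂(Measure.volumeIoiPow (Module.finrank ℝ (EuclideanSpace ℝ ι) - 1)) := by
  set μ := (volume : Measure (EuclideanSpace ℝ ι))
  rw [← integral_prod_mul (fun w : sphere (0 : EuclideanSpace ℝ ι) 1 => h w)
    (fun r : Set.Ioi (0 : ℝ) => r.1 ^ m * rexp (-r.1 ^ 2 / 2)),
    ← μ.measurePreserving_homeomorphUnitSphereProd.integral_comp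
      (Homeomorph.measurableEmbedding _)]
  have e : ∫ y, h y * rexp (-‖y‖ ^ 2 / 2) ∂μ
      = ∫ y : ({(0)}ᶜ : Set (EuclideanSpace ℝ ι)), h y * rexp (-‖y.1‖ ^ 2 / 2)
          ∂(μ.comap (↑)) := by
    rw [integral_subtype_comap (measurableSet_singleton _).compl
      fun y => h y * rexp (-‖y‖ ^ 2 / 2), restrict_compl_singleton]
  rw [e]
  refine integral_congr_ae (.of_forall fun y => ?_)
  have hy : 0 < ‖y.1‖ := norm_pos_iff.2 y.2
  have := hh ‖y.1‖ hy ((‖y.1‖)⁻¹ • y.1)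
  rw [smul_inv_smul₀ hy.ne'] at this
  simp [this]
  ring

lemma MvPolynomial.IsHomogeneous.eval_smul {κ : Type*} {m : ℕ} {P : MvPolynomial κ ℝ}
    (hP : P.IsHomogeneous m) (r : ℝ) (y : κ → ℝ) : eval (r • y) P = r ^ m * eval y P := by
  rw [eval_eq, eval_eq, Finset.mul_sum]
  refine Finset.sum_congr rfl fun d hd => ?_
  have h : Finsupp.weight (fun _ => 1) d = m := hP (mem_support_iff.1 hd)
  rw [← Finsupp.degree_eq_weight_one, Finsupp.degree_apply] at h
  simp only [Pi.smul_apply, smul_eq_mul, mul_pow, Finset.prod_mul_distrib]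
  rw [Finset.prod_pow_eq_pow_sum, ← h]
  ring

/-- Integration in polar coordinates of a homogeneous polynomial against the Gaussian weight. -/
lemma gaussianIntegral_mul_toSphere_univ [Nonempty ι] {m : ℕ} {P : MvPolynomial ι ℝ}
    (hP : P.IsHomogeneous m) :
    gaussianIntegral P * (volume : Measure (EuclideanSpace ℝ ι)).toSphere.real Set.univ
      = gaussianMoment ι m * ∫ w, eval (fun i => (w : EuclideanSpace ℝ ι) i) P
        ∂(volume : Measure (EuclideanSpace ℝ ι)).toSphere := by
  have h1 := integral_homogeneous_mul_gaussian (ι := ι) (m := m)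
    (h := fun y => eval (fun i => y i) P) fun r _ y => by
      exact hP.eval_smul r _
  have h2 := integral_homogeneous_mul_gaussian (ι := ι) (m := m)
    (h := fun y => ‖y‖ ^ m) fun r hr y => by
      rw [norm_smul, Real.norm_of_nonneg hr.le, mul_pow]
  rw [gaussianIntegral, gaussianMoment, h1, h2]
  simp
  ring

/-- The constant `M` in `∫ P(w) ⟪x, w⟫ ^ k dσ(w) = M P(x)` for harmonic `P` of degree `k`. -/
def harmonicMoment (ι : Type*) [Fintype ι] (k : ℕ) : ℝ :=
  (volume : Measure (EuclideanSpace ℝ ι)).toSphere.real Set.univ * k.factorial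
    * gaussianMoment ι 0 / gaussianMoment ι (2 * k)

lemma harmonicMoment_zero [Nonempty ι] :
    harmonicMoment ι 0 = (volume : Measure (EuclideanSpace ℝ ι)).toSphere.real Set.univ := by
  have := (gaussianMoment_pos (ι := ι) 0).ne'
  simp [harmonicMoment, this]

lemma harmonicMoment_succ [Nonempty ι] (k : ℕ) :
    (Fintype.card ι + 2 * k) * harmonicMoment ι (k + 1) = (k + 1) * harmonicMoment ι k := by
  have h1 := (gaussianMoment_pos (ι := ι) (2 * k)).ne'
  have h2 : (Fintype.card ι + 2 * k : ℝ) ≠ 0 := by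
    have : 0 < Fintype.card ι := Fintype.card_pos
    positivity
  rw [harmonicMoment, harmonicMoment, gaussianMoment_two_mul_add_two, Nat.factorial_succ]
  push_cast
  field_simp

lemma integral_harmonic_mul_inner_pow [Nonempty ι] (x : EuclideanSpace ℝ ι) {k : ℕ}
    {P : MvPolynomial ι ℝ} (hP : P.IsHomogeneous k) (hΔ : ∑ i, pderiv i (pderiv i P) = 0)
    {m : ℕ} (hm : m ≤ k) :
    ∫ w : sphere (0 : EuclideanSpace ℝ ι) 1, eval (fun i => w.1 i) P * ⟪x, w.1⟫ ^ m
        ∂(volume : Measure (EuclideanSpace ℝ ι)).toSphere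
      = if m = k then harmonicMoment ι k * eval (fun i => x i) P else 0 := by
  have hL := gaussianIntegral_mul_toSphere_univ
    (hP.mul ((isHomogeneous_linForm (fun i => x i)).pow m))
  have he (w : EuclideanSpace ℝ ι) : eval (fun i => w i) (linForm fun i => x i) = ⟪x, w⟫ := by
    simp [eval_linForm, PiLp.inner_apply, mul_comm]
  simp only [map_mul, map_pow, he, one_mul] at hL
  obtain ⟨h1, h2⟩ := gaussianIntegral_harmonic_mul_pow (fun i => x i) k hP hΔ
  apply mul_left_cancel₀ (gaussianMoment_pos (ι := ι) (k + m)).ne'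
  rw [← hL]
  split_ifs with hmk
  · subst hmk
    have h0 : gaussianIntegral (1 : MvPolynomial ι ℝ) = gaussianMoment ι 0 := by
      simp [gaussianIntegral, gaussianMoment]
    have h3 := (gaussianMoment_pos (ι := ι) (2 * m)).ne'
    rw [h2, h0, harmonicMoment, ← two_mul]
    field_simp
  · rw [h1 m (by omega), zero_mul, mul_zero]

end HarmonicPairing

section ZonalHarmonics

lemma natDegree_gegenbauer_le (μ : ℝ) (n : ℕ) :
    (gegenbauer μ (Polynomial.X : Polynomial ℝ) 1 (n + 2)).natDegree ≤ n := by
  induction n using Nat.strong_induction_on with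
  | _ n ih =>
    match n with
    | 0 => simp [gegenbauer]
    | 1 =>
      rw [gegenbauer]
      refine (Polynomial.natDegree_smul_le _ _).trans ?_
      simp only [gegenbauer, mul_zero, smul_zero, sub_zero, mul_one]
      exact (Polynomial.natDegree_smul_le _ _).trans Polynomial.natDegree_X_le
    | n + 2 =>
      rw [gegenbauer]
      refine (Polynomial.natDegree_smul_le _ _).trans
        ((Polynomial.natDegree_sub_le _ _).trans (max_le ?_ ?_))
      · refine (Polynomial.natDegree_smul_le _ _).trans (Polynomial.natDegree_mul_le.trans ?_)
        have := ih (n + 1) (by omega)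
        have hX : (Polynomial.X : Polynomial ℝ).natDegree ≤ 1 := Polynomial.natDegree_X_le
        omega
      · rw [one_mul]
        exact (Polynomial.natDegree_smul_le _ _).trans ((ih n (by omega)).trans (by omega))

/-- The coefficient of `t ^ n` in the Gegenbauer polynomial of degree `n`. -/
def gegenbauerLeadingCoeff (μ : ℝ) (n : ℕ) : ℝ :=
  (gegenbauer μ (Polynomial.X : Polynomial ℝ) 1 (n + 2)).coeff n

lemma gegenbauerLeadingCoeff_zero (μ : ℝ) : gegenbauerLeadingCoeff μ 0 = 1 := by
  simp [gegenbauerLeadingCoeff, gegenbauer]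

lemma gegenbauerLeadingCoeff_succ (μ : ℝ) (n : ℕ) :
    (n + 1) * gegenbauerLeadingCoeff μ (n + 1) = 2 * (n + μ) * gegenbauerLeadingCoeff μ n := by
  have h0 : (gegenbauer μ (Polynomial.X : Polynomial ℝ) 1 (n + 1)).coeff (n + 1) = 0 := by
    rcases n with _ | n
    · simp [gegenbauer]
    · exact Polynomial.coeff_eq_zero_of_natDegree_lt
        ((natDegree_gegenbauer_le μ n).trans_lt (by omega))
  have hn : (n : ℝ) + 1 ≠ 0 := by positivity
  rw [gegenbauerLeadingCoeff, gegenbauer]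
  simp only [Polynomial.coeff_smul, Polynomial.coeff_sub, one_mul, h0, Polynomial.coeff_X_mul,
    smul_eq_mul, mul_zero, sub_zero]
  rw [← gegenbauerLeadingCoeff]
  field_simp

variable {ι : Type*} [Fintype ι] [Nonempty ι]

open MvPolynomial in
lemma integral_harmonic_mul_gegenbauer (μ : ℝ) (x : EuclideanSpace ℝ ι) {k : ℕ}
    {P : MvPolynomial ι ℝ} (hP : P.IsHomogeneous k) (hΔ : ∑ i, pderiv i (pderiv i P) = 0) :
    ∫ w : sphere (0 : EuclideanSpace ℝ ι) 1,
        eval (fun i => w.1 i) P * gegenbauer μ ⟪x, w.1⟫ 1 (k + 2)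
        ∂(volume : Measure (EuclideanSpace ℝ ι)).toSphere
      = gegenbauerLeadingCoeff μ k * harmonicMoment ι k * eval (fun i => x i) P := by
  set p := gegenbauer μ (Polynomial.X : Polynomial ℝ) 1 (k + 2) with hp
  have he (t : ℝ) : gegenbauer μ t 1 (k + 2)
      = ∑ m ∈ Finset.range (k + 1), p.coeff m * t ^ m := by
    rw [← Polynomial.eval_eq_sum_range' (Nat.lt_succ_of_le (natDegree_gegenbauer_le μ k)),
      ← Polynomial.coe_aeval_eq_eval]
    change _ = Polynomial.aeval t _
    rw [map_gegenbauer]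
    simp
  have hc (m : ℕ) : Continuous fun w : sphere (0 : EuclideanSpace ℝ ι) 1 =>
      eval (fun i => w.1 i) P * (p.coeff m * ⟪x, w.1⟫ ^ m) :=
    ((continuous_eval_euclidean P).comp continuous_subtype_val).mul (by fun_prop)
  simp_rw [he, Finset.mul_sum]
  rw [integral_finsetSum _ fun m _ =>
    (hc m).integrable_of_hasCompactSupport (HasCompactSupport.of_compactSpace _)]
  have hI (m : ℕ) (hm : m ≤ k) : ∫ w : sphere (0 : EuclideanSpace ℝ ι) 1,
        eval (fun i => w.1 i) P * (p.coeff m * ⟪x, w.1⟫ ^ m)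
        ∂(volume : Measure (EuclideanSpace ℝ ι)).toSphere
      = p.coeff m * if m = k then harmonicMoment ι k * eval (fun i => x i) P else 0 := by
    rw [← integral_harmonic_mul_inner_pow x hP hΔ hm, ← integral_const_mul]
    simp_rw [mul_left_comm]
  rw [Finset.sum_congr rfl fun m hm => hI m (Nat.lt_succ_iff.1 (Finset.mem_range.1 hm)),
    Finset.sum_eq_single k (fun m _ hm => by simp [hm]) (by simp)]
  simp [gegenbauerLeadingCoeff, ← hp]
  ring

lemma gegenbauerLeadingCoeff_mul_harmonicMoment {μ : ℝ}
    (hd : (Fintype.card ι : ℝ) = 2 * μ + 2) (k : ℕ) :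
    (k + μ) * (gegenbauerLeadingCoeff μ k * harmonicMoment ι k)
      = μ * (volume : Measure (EuclideanSpace ℝ ι)).toSphere.real Set.univ := by
  induction k with
  | zero => simp [gegenbauerLeadingCoeff_zero, harmonicMoment_zero]
  | succ k ih =>
    have h1 := gegenbauerLeadingCoeff_succ μ k
    have h2 := harmonicMoment_succ (ι := ι) k
    rw [hd] at h2
    have hk : (k : ℝ) + 1 ≠ 0 := by positivity
    rw [← ih]
    apply mul_left_cancel₀ hk
    push_cast
    linear_combination ((k : ℝ) + 1 + μ) * harmonicMoment ι (k + 1) * h1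
      + (k + μ) * gegenbauerLeadingCoeff μ k * h2

end ZonalHarmonics

section ReproducingKernel

lemma continuous_of_isSphericalHarmonic {N k : ℕ} {g : Sph N → ℝ}
    (hg : IsSphericalHarmonic N k g) : Continuous g := by
  obtain ⟨P, -, -, h⟩ := hg
  rw [show g = _ from funext h]
  exact (continuous_eval_euclidean P).comp continuous_subtype_val

lemma isSphericalHarmonic_gegenbauer {N : ℕ} (x : Sph N) (k : ℕ) :
    IsSphericalHarmonic N k fun y => gegenbauer (((N : ℝ) - 1) / 2) ⟪x.1, y.1⟫ 1 (k + 2) := by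
  have hnorm (y : Sph N) : ∑ i, y.1 i ^ 2 = 1 := by
    have h := EuclideanSpace.real_norm_sq_eq y.1
    rw [norm_eq_of_mem_sphere y, one_pow] at h
    exact h.symm
  refine ⟨gegenbauer (((N : ℝ) - 1) / 2) (linForm fun i => x.1 i) (sumSq (Fin (N + 1))) (k + 2),
    isHomogeneous_gegenbauer _ _ k, laplacian_gegenbauer _ ?_ (hnorm x) _, fun y => ?_⟩
  · simp; ring
  · have hx : MvPolynomial.aeval (fun i => y.1 i) (linForm fun i => x.1 i) = ⟪x.1, y.1⟫ := by
      simp [linForm, PiLp.inner_apply, mul_comm]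
    have hy : MvPolynomial.aeval (fun i => y.1 i) (sumSq (Fin (N + 1))) = (1 : ℝ) := by
      simp [sumSq, hnorm]
    rw [← MvPolynomial.coe_aeval_eq_eval]
    change _ = MvPolynomial.aeval _ _
    rw [map_gegenbauer, hx, hy]

instance (N : ℕ) : IsFiniteMeasure (sphMeasure N) := by
  unfold sphMeasure; infer_instance

lemma integrable_sphMeasure_of_continuous {N : ℕ} {g : Sph N → ℝ} (hg : Continuous g) :
    Integrable g (sphMeasure N) :=
  hg.integrable_of_hasCompactSupport (HasCompactSupport.of_compactSpace g)

/-- The addition formula for spherical harmonics. -/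
lemma IsFourierLaplaceBasis.sum_mul_eq {N : ℕ} (hN : 2 ≤ N) {a : ℕ → ℕ}
    {Y : (k : ℕ) → Fin (a k) → Sph N → ℝ} (hY : IsFourierLaplaceBasis N a Y) (k : ℕ)
    (x y : Sph N) :
    ∑ j, Y k j x * Y k j y = ((sphMeasure N).real Set.univ)⁻¹ *
      (gegenbauer (((N : ℝ) - 1) / 2 + 1) ⟪x.1, y.1⟫ 1 (k + 2)
        - gegenbauer (((N : ℝ) - 1) / 2 + 1) ⟪x.1, y.1⟫ 1 k) := by
  set l : ℝ := ((N : ℝ) - 1) / 2 with hl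
  have hl0 : 0 < l := by
    have : (2 : ℝ) ≤ N := by exact_mod_cast hN
    rw [hl]; linarith
  set κ := gegenbauerLeadingCoeff l k * harmonicMoment (Fin (N + 1)) k with hκ
  have hYc (j : Fin (a k)) := continuous_of_isSphericalHarmonic (hY.harmonic k j)
  have hrep (j : Fin (a k)) : ∫ y, Y k j y * gegenbauer l ⟪x.1, y.1⟫ 1 (k + 2) ∂(sphMeasure N)
      = κ * Y k j x := by
    obtain ⟨P, hP, hΔ, hYP⟩ := hY.harmonic k j
    simp_rw [hYP]
    exact integral_harmonic_mul_gegenbauer l x.1 hP hΔ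
  obtain ⟨c, hc⟩ := (Submodule.mem_span_range_iff_exists_fun ℝ).1
    (hY.spanning k _ (isSphericalHarmonic_gegenbauer x k))
  have hz (y : Sph N) : gegenbauer l ⟪x.1, y.1⟫ 1 (k + 2) = ∑ j, c j * Y k j y := by
    have := congrFun hc y
    simpa using this.symm
  have hcj (j : Fin (a k)) : c j = κ * Y k j x := by
    rw [← hrep j]
    simp_rw [hz, Finset.mul_sum]
    rw [integral_finsetSum _ fun i _ => integrable_sphMeasure_of_continuous
      (g := fun y => Y k j y * (c i * Y k i y)) ((hYc j).mul (continuous_const.mul (hYc i)))]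
    simp_rw [mul_left_comm _ (c _), integral_const_mul, hY.orthonormal]
    simp
  have hsum : gegenbauer l ⟪x.1, y.1⟫ 1 (k + 2) = κ * ∑ j, Y k j x * Y k j y := by
    rw [hz, Finset.mul_sum]
    exact Finset.sum_congr rfl fun j _ => by rw [hcj]; ring
  have hg := gegenbauer_sub l ⟪x.1, y.1⟫ 1 k
  simp only [Algebra.algebraMap_self, RingHom.id_apply, one_mul] at hg
  have hM := gegenbauerLeadingCoeff_mul_harmonicMoment (ι := Fin (N + 1)) (μ := l)
    (by simp [hl]; ring) k
  have hσ : (sphMeasure N).real Set.univ ≠ 0 := by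
    rw [measureReal_ne_zero_iff, sphMeasure, Measure.measure_univ_ne_zero]
    exact Measure.toSphere_ne_zero _
  rw [← hκ] at hM
  change _ = l * (sphMeasure N).real Set.univ at hM
  rw [hsum] at hg
  rw [eq_inv_mul_iff_mul_eq₀ hσ]
  apply mul_left_cancel₀ hl0.ne'
  linear_combination hg - (∑ j, Y k j x * Y k j y) * hM

end ReproducingKernel

section MaximalFunction

variable {N : ℕ}

lemma continuous_inner_left (x : Sph N) : Continuous fun y : Sph N => ⟪x.1, y.1⟫ := by
  fun_prop

lemma measurableSet_sphBall (x : Sph N) (r : ℝ) : MeasurableSet (sphBall x r) :=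
  (isClosed_le (Real.continuous_arccos.comp (continuous_inner_left x))
    continuous_const).measurableSet

lemma inner_mem_Icc (x y : Sph N) : ⟪x.1, y.1⟫ ∈ Set.Icc (-1 : ℝ) 1 := by
  have h := abs_real_inner_le_norm x.1 y.1
  rw [norm_eq_of_mem_sphere x, norm_eq_of_mem_sphere y, one_mul] at h
  exact abs_le.1 h

lemma norm_sub_le_geoDist (x y : Sph N) : ‖y.1 - x.1‖ ≤ geoDist x y := by
  refine le_of_sq_le_sq ?_ (Real.arccos_nonneg _)
  have h := Real.one_sub_sq_div_two_le_cos (x := geoDist x y)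
  rw [geoDist, Real.cos_arccos (inner_mem_Icc x y).1 (inner_mem_Icc x y).2] at h
  rw [norm_sub_sq_real, norm_eq_of_mem_sphere x, norm_eq_of_mem_sphere y, real_inner_comm]
  rw [geoDist]
  linarith

open scoped Pointwise in
lemma cone_sphBall_subset (x : Sph N) {r : ℝ} (hr : 0 < r) :
    Set.Ioo (0 : ℝ) 1 • ((↑) '' sphBall x r : Set (EuclideanSpace ℝ (Fin (N + 1))))
      ⊆ ⋃ m ∈ Finset.range (⌊1 / r⌋₊ + 1), closedBall (((m : ℝ) * r) • x.1) (2 * r) := by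
  rintro _ ⟨τ, ⟨hτ0, hτ1⟩, _, ⟨y, hy, rfl⟩, rfl⟩
  simp only [Set.mem_iUnion, Finset.mem_range, exists_prop, mem_closedBall, dist_eq_norm]
  refine ⟨⌊τ / r⌋₊, Nat.lt_succ_of_le (Nat.floor_mono (by gcongr)), ?_⟩
  have h1 : ‖τ - ⌊τ / r⌋₊ * r‖ ≤ r := by
    have h2 := Nat.floor_le (div_nonneg hτ0.le hr.le)
    have h3 := (Nat.lt_floor_add_one (τ / r)).le
    rw [le_div_iff₀ hr] at h2
    rw [div_le_iff₀ hr] at h3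
    rw [Real.norm_eq_abs, abs_le]
    constructor <;> linarith
  have h4 : ‖y.1 - x.1‖ ≤ r := (norm_sub_le_geoDist x y).trans hy
  calc ‖τ • y.1 - ((⌊τ / r⌋₊ : ℝ) * r) • x.1‖
      = ‖τ • (y.1 - x.1) + (τ - ⌊τ / r⌋₊ * r) • x.1‖ := by
        congr 1; rw [smul_sub, sub_smul]; abel
    _ ≤ ‖τ • (y.1 - x.1)‖ + ‖(τ - ⌊τ / r⌋₊ * r) • x.1‖ := norm_add_le _ _
    _ ≤ 1 * r + r * 1 := by
        rw [norm_smul, norm_smul, norm_eq_of_mem_sphere x, Real.norm_eq_abs, abs_of_pos hτ0]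
        gcongr
    _ = 2 * r := by ring

/-- The surface measure of a spherical cap of radius `r` is at most a multiple of `r ^ N`. -/
lemma exists_sphMeasure_sphBall_le (N : ℕ) : ∃ C : ℝ≥0, ∀ (x : Sph N) (r : ℝ), 0 < r →
    sphMeasure N (sphBall x r) ≤ C * ENNReal.ofReal (r ^ N) := by
  set V := (volume : Measure (EuclideanSpace ℝ (Fin (N + 1)))) (ball 0 1) with hV
  have hVt : V ≠ ∞ := measure_ball_lt_top.ne
  set C₁ : ℝ≥0∞ := (N + 1 : ℕ) * ENNReal.ofReal (2 ^ (N + 2)) * V with hC₁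
  have hC₁t : C₁ ≠ ∞ := by finiteness
  have hσt : sphMeasure N Set.univ ≠ ∞ := by finiteness
  refine ⟨(C₁ + sphMeasure N Set.univ).toNNReal, fun x r hr => ?_⟩
  rw [ENNReal.coe_toNNReal (by finiteness)]
  rcases le_total r 1 with hr1 | hr1
  · refine le_trans ?_ (mul_le_mul_left (le_self_add (a := C₁)) _)
    rw [sphMeasure, Measure.toSphere_apply' _ (measurableSet_sphBall x r)]
    have hcount : ((⌊1 / r⌋₊ + 1 : ℕ) : ℝ) * (2 * r) ^ (N + 1) ≤ 2 ^ (N + 2) * r ^ N := by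
      have h1 : ((⌊1 / r⌋₊ + 1 : ℕ) : ℝ) ≤ 2 / r := by
        have h2 := Nat.floor_le (one_div_nonneg.2 hr.le)
        have h3 : 1 ≤ 1 / r := by rwa [one_le_div hr]
        push_cast
        calc (⌊1 / r⌋₊ : ℝ) + 1 ≤ 1 / r + 1 / r := by linarith
          _ = 2 / r := by ring
      calc _ ≤ 2 / r * (2 * r) ^ (N + 1) := by gcongr
        _ = _ := by field_simp; ring
    calc _ ≤ (Module.finrank ℝ (EuclideanSpace ℝ (Fin (N + 1))) : ℝ≥0∞) *
          ∑ m ∈ Finset.range (⌊1 / r⌋₊ + 1), volume (closedBall (((m : ℝ) * r) • x.1) (2 * r)) := by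
          gcongr
          exact (measure_mono (cone_sphBall_subset x hr)).trans
            (measure_biUnion_finset_le (μ := volume) _ _)
      _ = (N + 1 : ℕ) * (ENNReal.ofReal (((⌊1 / r⌋₊ + 1 : ℕ) : ℝ) * (2 * r) ^ (N + 1)) * V) := by
          simp_rw [Measure.addHaar_closedBall _ _ (by positivity : 0 ≤ 2 * r)]
          rw [Finset.sum_const, Finset.card_range, nsmul_eq_mul, finrank_euclideanSpace_fin,
            ENNReal.ofReal_mul (by positivity), ENNReal.ofReal_natCast, mul_assoc]
      _ ≤ (N + 1 : ℕ) * (ENNReal.ofReal (2 ^ (N + 2) * r ^ N) * V) := by gcongr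
      _ = C₁ * ENNReal.ofReal (r ^ N) := by
          rw [hC₁, ENNReal.ofReal_mul (by positivity)]; ring
  · calc sphMeasure N (sphBall x r) ≤ sphMeasure N Set.univ * 1 := by
          rw [mul_one]; exact measure_mono (Set.subset_univ _)
      _ ≤ (C₁ + sphMeasure N Set.univ) * ENNReal.ofReal (r ^ N) := by
          gcongr
          · exact le_add_self
          · rw [ENNReal.one_le_ofReal]; exact one_le_pow₀ hr1

lemma setLIntegral_sphBall_le (f : Sph N → ℝ) (x : Sph N) {r : ℝ} (hr : 0 < r) :
    ∫⁻ y in sphBall x r, ENNReal.ofReal |f y| ∂(sphMeasure N)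
      ≤ sphMeasure N (sphBall x r) * hlMaximal f x := by
  rcases eq_or_ne (sphMeasure N (sphBall x r)) 0 with h | h
  · simp [setLIntegral_measure_zero _ _ h]
  · calc _ = sphMeasure N (sphBall x r) * ((sphMeasure N (sphBall x r))⁻¹ *
          ∫⁻ y in sphBall x r, ENNReal.ofReal |f y| ∂(sphMeasure N)) := by
          rw [← mul_assoc, ENNReal.mul_inv_cancel h (by finiteness), one_mul]
      _ ≤ _ := by
          gcongr
          exact le_iSup₂ (f := fun (r : ℝ) (_ : 0 < r) => (sphMeasure N (sphBall x r))⁻¹ *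
            ∫⁻ y in sphBall x r, ENNReal.ofReal |f y| ∂(sphMeasure N)) r hr

lemma arccos_le_of_sqrt_le {t ρ : ℝ} (ht : 0 ≤ t) (h : √(1 - t ^ 2) ≤ ρ) :
    Real.arccos t ≤ π / 2 * ρ := by
  rw [← Real.sin_arccos] at h
  have h1 := Real.mul_le_sin (Real.arccos_nonneg t) (Real.arccos_le_pi_div_two.2 ht)
  calc Real.arccos t = π / 2 * (2 / π * Real.arccos t) := by field_simp
    _ ≤ π / 2 * ρ := by gcongr; exact h1.trans h

lemma sqrt_le_subset_sphBall_union (x : Sph N) (ρ : ℝ) :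
    {y : Sph N | √(1 - ⟪x.1, y.1⟫ ^ 2) ≤ ρ}
      ⊆ sphBall x (π / 2 * ρ) ∪ sphBall (antipode x) (π / 2 * ρ) := by
  intro y hy
  rcases le_total 0 ⟪x.1, y.1⟫ with h | h
  · exact Or.inl (arccos_le_of_sqrt_le h hy)
  · refine Or.inr ?_
    have h1 : ⟪(antipode x).1, y.1⟫ = -⟪x.1, y.1⟫ := inner_neg_left _ _
    change Real.arccos ⟪(antipode x).1, y.1⟫ ≤ _
    rw [h1]
    exact arccos_le_of_sqrt_le (neg_nonneg.2 h) (by rw [neg_sq]; exact hy)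

/-- The integral of `|f|` over the union of two antipodal caps is controlled by the
maximal function at the two centres. -/
lemma exists_setLIntegral_sqrt_le (N : ℕ) : ∃ C : ℝ≥0, ∀ (f : Sph N → ℝ) (x : Sph N) (ρ : ℝ),
    0 < ρ → ∫⁻ y in {y : Sph N | √(1 - ⟪x.1, y.1⟫ ^ 2) ≤ ρ}, ENNReal.ofReal |f y| ∂(sphMeasure N)
      ≤ C * (hlMaximal f x + hlMaximal f (antipode x)) * ENNReal.ofReal (ρ ^ N) := by
  obtain ⟨C, hC⟩ := exists_sphMeasure_sphBall_le N
  refine ⟨C * Real.toNNReal ((π / 2) ^ N), fun f x ρ hρ => ?_⟩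
  have hr : 0 < π / 2 * ρ := by positivity
  calc _ ≤ ∫⁻ y in sphBall x (π / 2 * ρ) ∪ sphBall (antipode x) (π / 2 * ρ),
        ENNReal.ofReal |f y| ∂(sphMeasure N) :=
        lintegral_mono_set (sqrt_le_subset_sphBall_union x ρ)
    _ ≤ _ := lintegral_union_le _ _ _
    _ ≤ C * ENNReal.ofReal ((π / 2 * ρ) ^ N) * hlMaximal f x
        + C * ENNReal.ofReal ((π / 2 * ρ) ^ N) * hlMaximal f (antipode x) := by
        gcongr
        · exact (setLIntegral_sphBall_le f x hr).trans (mul_le_mul_left (hC x _ hr) _)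
        · exact (setLIntegral_sphBall_le f _ hr).trans (mul_le_mul_left (hC _ _ hr) _)
    _ = _ := by
        rw [mul_pow, ENNReal.ofReal_mul (by positivity), ENNReal.coe_mul]
        change _ = C * ENNReal.ofReal ((π / 2) ^ N) * _ * _
        ring

end MaximalFunction

section Dyadic

lemma exists_rpow_mul_rpow_le (N : ℕ) {ε s η : ℝ} (hε : 0 < ε) (hs : 0 < s) (hη : 0 ≤ η) :
    ∃ m : ℕ, η ≤ 2 ^ (m + 1) * s ∧
      s ^ ε * (s + η) ^ (-(N + ε)) ≤ ((2 ^ m * s) ^ N)⁻¹ * ((2 : ℝ) ^ (-ε)) ^ m := by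
  obtain ⟨m, hm1, hm2⟩ := exists_nat_pow_near (x := (s + η) / s) (y := (2 : ℝ))
    (by rw [le_div_iff₀ hs]; linarith) one_lt_two
  rw [le_div_iff₀ hs] at hm1
  rw [div_lt_iff₀ hs] at hm2
  refine ⟨m, by linarith, ?_⟩
  have h2 : (0 : ℝ) < 2 ^ m := by positivity
  calc s ^ ε * (s + η) ^ (-(N + ε)) ≤ s ^ ε * (2 ^ m * s) ^ (-(N + ε)) := by
        have hN : -((N : ℝ) + ε) ≤ 0 := neg_nonpos.2 (by positivity)
        exact mul_le_mul_of_nonneg_left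
          (Real.rpow_le_rpow_of_nonpos (by positivity) hm1 hN) (by positivity)
    _ = s ^ ε * ((2 ^ m * s) ^ (-(N : ℝ)) * (((2 : ℝ) ^ m) ^ (-ε) * s ^ (-ε))) := by
        rw [neg_add, Real.rpow_add (by positivity), Real.mul_rpow h2.le hs.le (z := -ε)]
    _ = (s ^ ε * s ^ (-ε)) * ((2 ^ m * s) ^ (-(N : ℝ)) * ((2 : ℝ) ^ m) ^ (-ε)) := by ring
    _ = ((2 ^ m * s) ^ N)⁻¹ * ((2 : ℝ) ^ (-ε)) ^ m := by
        rw [← Real.rpow_add hs, add_neg_cancel, Real.rpow_zero, one_mul,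
          Real.rpow_neg (by positivity), Real.rpow_natCast, ← Real.rpow_natCast 2 m,
          ← Real.rpow_natCast (2 ^ (-ε)) m, ← Real.rpow_mul two_pos.le,
          ← Real.rpow_mul two_pos.le, mul_comm (-ε)]

/-- A kernel with dyadic decay in `η` integrates against any `g` whose mass on sublevel sets
of `η` grows at most like the `N`-th power of the level. -/
lemma exists_lintegral_rpow_mul_le (N : ℕ) {ε : ℝ} (hε : 0 < ε) : ∃ C : ℝ≥0,
    ∀ {X : Type} [MeasurableSpace X] (μ : Measure X) (η : X → ℝ) (g : X → ℝ≥0∞) (K : ℝ≥0∞),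
      Measurable η → (∀ y, 0 ≤ η y) → AEMeasurable g μ →
      (∀ ρ, 0 < ρ → ∫⁻ y in {y | η y ≤ ρ}, g y ∂μ ≤ K * ENNReal.ofReal (ρ ^ N)) →
      ∀ s, 0 < s →
        ∫⁻ y, ENNReal.ofReal (s ^ ε * (s + η y) ^ (-(N + ε))) * g y ∂μ ≤ C * K := by
  set q : ℝ≥0∞ := ENNReal.ofReal ((2 : ℝ) ^ (-ε)) with hq
  have hq1 : q < 1 := by
    rw [hq, ENNReal.ofReal_lt_one]
    exact Real.rpow_lt_one_of_one_lt_of_neg one_lt_two (by linarith)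
  have hqt : (1 - q)⁻¹ ≠ ∞ := ENNReal.inv_ne_top.2 (tsub_pos_of_lt hq1).ne'
  refine ⟨2 ^ N * ((1 - q)⁻¹).toNNReal, fun {X} _ μ η g K hη hη0 hg hK s hs => ?_⟩
  set E : ℕ → Set X := fun m => {y | η y ≤ 2 ^ (m + 1) * s} with hE
  have hEm (m : ℕ) : MeasurableSet (E m) := measurableSet_le hη measurable_const
  set w : ℕ → ℝ≥0∞ := fun m => ENNReal.ofReal (((2 ^ m * s) ^ N)⁻¹ * ((2 : ℝ) ^ (-ε)) ^ m) with hw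
  have hpt (y : X) : ENNReal.ofReal (s ^ ε * (s + η y) ^ (-(N + ε))) * g y
      ≤ ∑' m, w m * (E m).indicator g y := by
    obtain ⟨m, hm1, hm2⟩ := exists_rpow_mul_rpow_le N hε hs (hη0 y)
    refine le_trans ?_ (ENNReal.le_tsum m)
    rw [Set.indicator_of_mem (show y ∈ E m from hm1)]
    gcongr
    exact ENNReal.ofReal_le_ofReal hm2
  have hterm (m : ℕ) : w m * ∫⁻ y in E m, g y ∂μ ≤ q ^ m * (2 ^ N * K) := by
    calc _ ≤ w m * (K * ENNReal.ofReal ((2 ^ (m + 1) * s) ^ N)) := by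
          gcongr; exact hK _ (by positivity)
      _ = ENNReal.ofReal
          (((2 ^ m * s) ^ N)⁻¹ * ((2 : ℝ) ^ (-ε)) ^ m * (2 ^ (m + 1) * s) ^ N) * K := by
          rw [ENNReal.ofReal_mul (by positivity)]; ring
      _ = ENNReal.ofReal (((2 : ℝ) ^ (-ε)) ^ m * 2 ^ N) * K := by
          congr 2
          rw [pow_succ' 2 m, mul_assoc 2, mul_pow 2]
          have : (2 ^ m * s) ^ N ≠ 0 := by positivity
          field_simp
      _ = q ^ m * (2 ^ N * K) := by
          rw [ENNReal.ofReal_mul (by positivity), ENNReal.ofReal_pow (by positivity),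
            ENNReal.ofReal_pow two_pos.le, ENNReal.ofReal_ofNat, mul_assoc]
  calc _ ≤ ∫⁻ y, ∑' m, w m * (E m).indicator g y ∂μ := lintegral_mono hpt
    _ = ∑' m, w m * ∫⁻ y in E m, g y ∂μ := by
        rw [lintegral_tsum fun m => (hg.indicator (hEm m)).const_mul _]
        refine tsum_congr fun m => ?_
        rw [lintegral_const_mul' _ _ ENNReal.ofReal_ne_top, lintegral_indicator (hEm m)]
    _ ≤ ∑' m, q ^ m * (2 ^ N * K) := ENNReal.tsum_le_tsum hterm
    _ = _ := by
        rw [ENNReal.tsum_mul_right, ENNReal.tsum_geometric, ENNReal.coe_mul,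
          ENNReal.coe_toNNReal hqt]
        push_cast
        ring

end Dyadic

section CesaroMeans

variable {N : ℕ} {a : ℕ → ℕ} {Y : (k : ℕ) → Fin (a k) → Sph N → ℝ}

lemma IsFourierLaplaceBasis.integrable_mul (hY : IsFourierLaplaceBasis N a Y) {f : Sph N → ℝ}
    (hf : Integrable f (sphMeasure N)) (k : ℕ) (j : Fin (a k)) :
    Integrable (fun y => f y * Y k j y) (sphMeasure N) := by
  have hc := continuous_of_isSphericalHarmonic (hY.harmonic k j)
  obtain ⟨B, hB⟩ := isCompact_univ.exists_bound_of_continuousOn hc.continuousOn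
  exact hf.mul_bdd (c := B) hc.aestronglyMeasurable (ae_of_all _ fun y => hB y (Set.mem_univ y))

lemma IsFourierLaplaceBasis.cesaroMean_eq_integral (hY : IsFourierLaplaceBasis N a Y) (α : ℝ)
    {f : Sph N → ℝ} (hf : Integrable f (sphMeasure N)) (n : ℕ) (x : Sph N) :
    cesaroMean Y α f n x = ∫ y, f y * cesaroKernel Y α n x y ∂(sphMeasure N) := by
  have h (y : Sph N) : f y * cesaroKernel Y α n x y = (cesaroA α n)⁻¹ *
      ∑ k ∈ Finset.range (n + 1), cesaroA α (n - k) * ∑ j, (f y * Y k j y) * Y k j x := by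
    rw [cesaroKernel, mul_left_comm, Finset.mul_sum]
    congr 1
    refine Finset.sum_congr rfl fun k _ => ?_
    rw [mul_left_comm, Finset.mul_sum]
    congr 1
    exact Finset.sum_congr rfl fun j _ => by ring
  have hI (k : ℕ) (j : Fin (a k)) := (hY.integrable_mul hf k j).mul_const (Y k j x)
  simp_rw [h]
  rw [integral_const_mul, integral_finsetSum _ fun k _ =>
    (integrable_finsetSum _ fun j _ => hI k j).const_mul _]
  rw [cesaroMean]
  congr 1
  refine Finset.sum_congr rfl fun k _ => ?_
  rw [integral_const_mul, integral_finsetSum _ fun j _ => hI k j]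
  simp_rw [integral_mul_const, flCoeff]

/-- The pointwise bound for the Cesàro kernel above the critical index. -/
lemma IsFourierLaplaceBasis.exists_abs_cesaroKernel_le (hN : 2 ≤ N)
    (hY : IsFourierLaplaceBasis N a Y) {α ε : ℝ} (hε : 0 < ε) (hε1 : ε ≤ 1)
    (hεα : ε ≤ α - ((N : ℝ) - 1) / 2) : ∃ C : ℝ≥0, ∀ n : ℕ, 1 ≤ n → ∀ x y : Sph N,
      |cesaroKernel Y α n x y| ≤ C * ((1 / ((n : ℝ) + 1)) ^ ε *
        (1 / ((n : ℝ) + 1) + √(1 - ⟪x.1, y.1⟫ ^ 2)) ^ (-(N + ε))) := by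
  have hl : 0 < ((N : ℝ) - 1) / 2 := by
    have : (2 : ℝ) ≤ N := by exact_mod_cast hN
    linarith
  obtain ⟨C, hC, h⟩ := exists_abs_cesaro_gegenbauer_le hl hε hε1 hεα
  set M := (sphMeasure N).real Set.univ
  refine ⟨(M⁻¹ * C).toNNReal, fun n hn x y => ?_⟩
  have ht : ⟪x.1, y.1⟫ ^ 2 ≤ 1 := by
    have := inner_mem_Icc x y
    rw [sq_le_one_iff_abs_le_one]
    exact abs_le.2 this
  have hK : cesaroKernel Y α n x y = M⁻¹ * ((cesaroA α n)⁻¹ * ∑ k ∈ Finset.range (n + 1),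
      cesaroA α (n - k) * (gegenbauer (((N : ℝ) - 1) / 2 + 1) ⟪x.1, y.1⟫ 1 (k + 2)
        - gegenbauer (((N : ℝ) - 1) / 2 + 1) ⟪x.1, y.1⟫ 1 k)) := by
    rw [cesaroKernel, mul_left_comm M⁻¹, Finset.mul_sum (a := M⁻¹)]
    congr 1
    refine Finset.sum_congr rfl fun k _ => ?_
    rw [hY.sum_mul_eq hN, mul_left_comm]
  have h1 := h n hn _ ht
  rw [show 2 * (((N : ℝ) - 1) / 2) + 1 + ε = N + ε by ring] at h1
  rw [hK, abs_mul, abs_of_nonneg (by positivity : 0 ≤ M⁻¹),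
    Real.coe_toNNReal _ (by positivity), mul_assoc]
  gcongr

end CesaroMeans

/-- For `N ≥ 2`, `f ∈ L¹(S^N)` and `α > (N−1)/2` there is a constant `c_α`,
not depending on `f`, such that `S_*^α f(x) ≤ c_α (f*(x) + f*(x̄))` for every `x ∈ S^N`. -/
theorem cesaro_maximal_le_hlMaximal
    (N : ℕ) (hN : 2 ≤ N) (a : ℕ → ℕ) (Y : (k : ℕ) → Fin (a k) → Sph N → ℝ)
    (hY : IsFourierLaplaceBasis N a Y) (α : ℝ) (hα : ((N : ℝ) - 1) / 2 < α) :
    ∃ c : ℝ≥0, ∀ f : Sph N → ℝ, Integrable f (sphMeasure N) → ∀ x : Sph N,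
      cesaroMaximal Y α f x ≤ c * (hlMaximal f x + hlMaximal f (antipode x)) := by
  set ε : ℝ := min (α - ((N : ℝ) - 1) / 2) 1 with hεdef
  have hε : 0 < ε := lt_min (sub_pos.2 hα) one_pos
  obtain ⟨C₁, hC₁⟩ := hY.exists_abs_cesaroKernel_le hN hε (min_le_right _ _) (min_le_left _ _)
  obtain ⟨C₂, hC₂⟩ := exists_lintegral_rpow_mul_le N hε
  obtain ⟨C₃, hC₃⟩ := exists_setLIntegral_sqrt_le N
  refine ⟨C₁ * (C₂ * C₃), fun f hf x => iSup₂_le fun n hn => ?_⟩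
  have hs : 0 < 1 / ((n : ℝ) + 1) := by positivity
  have hη : Measurable fun y : Sph N => √(1 - ⟪x.1, y.1⟫ ^ 2) :=
    ((continuous_const.sub ((continuous_inner_left x).pow 2)).sqrt).measurable
  have hg : AEMeasurable (fun y => ENNReal.ofReal |f y|) (sphMeasure N) :=
    hf.aestronglyMeasurable.norm.aemeasurable.ennreal_ofReal
  have hpt (y : Sph N) : ‖f y * cesaroKernel Y α n x y‖ₑ ≤ C₁ * (ENNReal.ofReal
      ((1 / ((n : ℝ) + 1)) ^ ε * (1 / ((n : ℝ) + 1) + √(1 - ⟪x.1, y.1⟫ ^ 2)) ^ (-(N + ε)))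
        * ENNReal.ofReal |f y|) := by
    rw [enorm_mul, mul_comm, ← mul_assoc, Real.enorm_eq_ofReal_abs, Real.enorm_eq_ofReal_abs]
    gcongr
    refine (ENNReal.ofReal_le_ofReal (hC₁ n hn x y)).trans_eq ?_
    rw [ENNReal.ofReal_mul C₁.coe_nonneg, ENNReal.ofReal_coe_nnreal]
  rw [hY.cesaroMean_eq_integral α hf, ← Real.enorm_eq_ofReal_abs]
  calc _ ≤ ∫⁻ y, ‖f y * cesaroKernel Y α n x y‖ₑ ∂(sphMeasure N) :=
        enorm_integral_le_lintegral_enorm _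
    _ ≤ _ := lintegral_mono hpt
    _ ≤ C₁ * (C₂ * (C₃ * (hlMaximal f x + hlMaximal f (antipode x)))) := by
        rw [lintegral_const_mul' _ _ ENNReal.coe_ne_top]
        gcongr
        exact hC₂ _ _ _ _ hη (fun _ => Real.sqrt_nonneg _) hg (hC₃ f x) _ hs
    _ = _ := by push_cast; ring
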